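/- arXiv:2605.28776 — 7 statements merged into one kernel-verified Lean document; each statement's English description precedes it below -/
import Mathlib

section
/- Let (W, W') be an exchangeable pair of real random variables on a probability space, i.e. the joint law of (W, W') equals the joint law of (W', W). Assume E W = 0, E W² = 1 and E|W|³ < ∞, and suppose there exist a constant λ ∈ (0,1) and random variables R₁, R₂, each measurable with respect to the σ-algebra generated by W, such that E(W' − W | W) = −λ(W + R₁) almost surely and E((W' − W)² | W) = 2λ(1 + R₂) almost surely. Then for every function h : ℝ → ℝ with Lipschitz constant at most 1, |E h(W) − ∫ h dN(0,1)| ≤ E|R₁| + √(2/π) · E|R₂| + (1/(3λ)) · E|W' − W|³. -/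
open MeasureTheory ProbabilityTheory Real

namespace SteinNormal

open Set Filter Topology

/-- The density of the standard normal distribution. -/
noncomputable def pdf (x : ℝ) : ℝ := gaussianPDFReal 0 1 x

/-- The distribution function of the standard normal distribution. -/
noncomputable def cdf (x : ℝ) : ℝ := ∫ t in Iic x, pdf t

/-- The antiderivative of `cdf` that vanishes at `-∞`. -/
noncomputable def cdfInt (x : ℝ) : ℝ := x * cdf x + pdf x

theorem pdf_eq (x : ℝ) : pdf x = (√(2 * π))⁻¹ * exp (-(1 / 2) * x ^ 2) := by
  simp only [pdf, gaussianPDFReal, NNReal.coe_one, mul_one, sub_zero]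
  ring_nf

theorem pdf_pos (x : ℝ) : 0 < pdf x := gaussianPDFReal_pos 0 1 x one_ne_zero

@[simp] theorem pdf_neg (x : ℝ) : pdf (-x) = pdf x := by simp [pdf_eq]

theorem hasDerivAt_pdf (x : ℝ) : HasDerivAt pdf (-(x * pdf x)) x := by
  have h : HasDerivAt (fun y : ℝ => (√(2 * π))⁻¹ * exp (-(1 / 2) * y ^ 2)) (-(x * pdf x)) x := by
    convert! ((((hasDerivAt_id x).pow 2).const_mul (-(1 / 2) : ℝ)).exp.const_mul
      (√(2 * π))⁻¹) using 1
    rw [pdf_eq]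
    simp
    ring
  rwa [← show pdf = _ from funext pdf_eq] at h

theorem continuous_pdf : Continuous pdf :=
  continuous_iff_continuousAt.2 fun x => (hasDerivAt_pdf x).continuousAt

theorem integrable_pdf : Integrable pdf := integrable_gaussianPDFReal 0 1

theorem tendsto_pdf_cocompact : Tendsto pdf (cocompact ℝ) (𝓝 0) := by
  have := (tendsto_rpow_abs_mul_exp_neg_mul_sq_cocompact (a := 1 / 2) (by norm_num) 0).const_mul
    (√(2 * π))⁻¹
  rw [mul_zero] at this
  refine this.congr fun x => ?_
  simp [pdf_eq]

theorem tendsto_id_mul_pdf_cocompact :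
    Tendsto (fun x => x * pdf x) (cocompact ℝ) (𝓝 0) := by
  have := (tendsto_rpow_abs_mul_exp_neg_mul_sq_cocompact (a := 1 / 2) (by norm_num) 1).const_mul
    (√(2 * π))⁻¹
  rw [mul_zero] at this
  refine squeeze_zero_norm (fun x => le_of_eq ?_) this
  rw [norm_mul, Real.norm_eq_abs, Real.norm_of_nonneg (pdf_pos x).le, pdf_eq, rpow_one]
  ring

theorem tendsto_pdf_atBot : Tendsto pdf atBot (𝓝 0) :=
  tendsto_pdf_cocompact.mono_left atBot_le_cocompact

theorem tendsto_pdf_atTop : Tendsto pdf atTop (𝓝 0) :=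
  tendsto_pdf_cocompact.mono_left atTop_le_cocompact

theorem tendsto_id_mul_pdf_atBot : Tendsto (fun x => x * pdf x) atBot (𝓝 0) :=
  tendsto_id_mul_pdf_cocompact.mono_left atBot_le_cocompact

theorem integrable_id_mul_pdf : Integrable fun x => x * pdf x := by
  have := (integrable_mul_exp_neg_mul_sq (b := 1 / 2) (by norm_num)).const_mul (√(2 * π))⁻¹
  refine this.congr (Eventually.of_forall fun x => ?_)
  simp only [pdf_eq]
  ring

theorem hasDerivAt_integral_Iic {g : ℝ → ℝ} (hg : Continuous g)
    (hgi : ∀ x, IntegrableOn g (Iic x)) (x : ℝ) :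
    HasDerivAt (fun y => ∫ t in Iic y, g t) (g x) x := by
  have h : HasDerivAt (fun y => (∫ t in Iic (0 : ℝ), g t) + ∫ t in (0 : ℝ)..y, g t) (g x) x :=
    (intervalIntegral.integral_hasDerivAt_right (hg.intervalIntegrable _ _)
      hg.stronglyMeasurable.stronglyMeasurableAtFilter hg.continuousAt).const_add _
  convert! h using 2 with y
  rw [← intervalIntegral.integral_Iic_sub_Iic (hgi 0) (hgi y)]
  ring

theorem hasDerivAt_cdf (x : ℝ) : HasDerivAt cdf (pdf x) x :=
  hasDerivAt_integral_Iic continuous_pdf (fun _ => integrable_pdf.integrableOn) x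

theorem continuous_cdf : Continuous cdf :=
  continuous_iff_continuousAt.2 fun x => (hasDerivAt_cdf x).continuousAt

theorem cdf_add_cdf_neg (x : ℝ) : cdf x + cdf (-x) = 1 := by
  have h : cdf (-x) = ∫ t in Ioi x, pdf t := by
    have := integral_comp_neg_Iic (-x) pdf
    simpa only [pdf_neg, neg_neg, cdf] using this
  rw [h, cdf, intervalIntegral.integral_Iic_add_Ioi integrable_pdf.integrableOn
    integrable_pdf.integrableOn]
  exact integral_gaussianPDFReal_eq_one 0 one_ne_zero

theorem strictMono_cdf : StrictMono cdf :=
  strictMono_of_deriv_pos fun x => by rw [(hasDerivAt_cdf x).deriv]; exact pdf_pos x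

theorem cdf_pos (x : ℝ) : 0 < cdf x := by
  have h : 0 ≤ cdf (x - 1) := setIntegral_nonneg measurableSet_Iic fun t _ => (pdf_pos t).le
  exact h.trans_lt (strictMono_cdf (by linarith))

theorem hasDerivAt_cdfInt (x : ℝ) : HasDerivAt cdfInt (cdf x) x := by
  convert! ((hasDerivAt_id x).mul (hasDerivAt_cdf x)).add (hasDerivAt_pdf x) using 1
  simp

theorem strictMono_cdfInt : StrictMono cdfInt :=
  strictMono_of_deriv_pos fun x => by rw [(hasDerivAt_cdfInt x).deriv]; exact cdf_pos x

theorem integral_Iic_id_mul_pdf (x : ℝ) : ∫ t in Iic x, t * pdf t = -pdf x := by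
  have h := integral_Iic_of_hasDerivAt_of_tendsto' (a := x) (f := pdf)
    (fun y _ => hasDerivAt_pdf y) integrable_id_mul_pdf.neg.integrableOn tendsto_pdf_atBot
  rw [integral_neg] at h
  linarith

theorem cdfInt_pos (x : ℝ) : 0 < cdfInt x := by
  have h (y : ℝ) : 0 ≤ cdfInt y := by
    have : ∫ t in Iic y, t * pdf t ≤ ∫ t in Iic y, y * pdf t :=
      setIntegral_mono_on integrable_id_mul_pdf.integrableOn
        (integrable_pdf.const_mul y).integrableOn measurableSet_Iic
        fun t ht => mul_le_mul_of_nonneg_right ht (pdf_pos t).le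
    rw [integral_Iic_id_mul_pdf, integral_const_mul] at this
    rw [cdfInt, cdf]
    linarith
  exact (h (x - 1)).trans_lt (strictMono_cdfInt (by linarith))

theorem tendsto_cdfInt_atBot : Tendsto cdfInt atBot (𝓝 0) := by
  refine squeeze_zero' (Eventually.of_forall fun x => (cdfInt_pos x).le) ?_ tendsto_pdf_atBot
  filter_upwards [eventually_le_atBot 0] with x hx
  have := mul_nonpos_of_nonpos_of_nonneg hx (cdf_pos x).le
  rw [cdfInt]
  linarith

/-- The lower bound on the Mills ratio. -/
theorem mills_lower_bound (x : ℝ) : 0 ≤ (1 + x ^ 2) * cdf x + x * pdf x := by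
  have hd (y : ℝ) : HasDerivAt (fun x => (1 + x ^ 2) * cdf x + x * pdf x) (2 * cdfInt y) y := by
    convert! ((((hasDerivAt_id y).pow 2).const_add 1).mul (hasDerivAt_cdf y)).add
      ((hasDerivAt_id y).mul (hasDerivAt_pdf y)) using 1
    simp [cdfInt]
    ring
  have hmono : Monotone (fun x => (1 + x ^ 2) * cdf x + x * pdf x) :=
    monotone_of_hasDerivAt_nonneg hd fun y => by have := cdfInt_pos y; simp; linarith
  refine le_of_tendsto tendsto_id_mul_pdf_atBot ?_
  filter_upwards [eventually_le_atBot x] with y hy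
  have h1 := hmono hy
  have h2 : 0 ≤ (1 + y ^ 2) * cdf y := by have := cdf_pos y; positivity
  simp only at h1
  linarith

theorem integrableOn_Iic_mul_cdf {g : ℝ → ℝ} (hg : Continuous g) (hb : ∀ x, |g x| ≤ 1) (x : ℝ) :
    IntegrableOn (fun t => g t * cdf t) (Iic x) := by
  have h1 : IntegrableOn cdf (Iic x) := by
    refine integrableOn_Iic_of_intervalIntegral_norm_bounded (cdfInt x) x
      (fun i => continuous_cdf.integrableOn_Ioc) tendsto_id (Eventually.of_forall fun a => ?_)
    simp only [Real.norm_of_nonneg (cdf_pos _).le]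
    rw [intervalIntegral.integral_eq_sub_of_hasDerivAt (fun y _ => hasDerivAt_cdfInt y)
      (continuous_cdf.intervalIntegrable _ _)]
    have := cdfInt_pos a
    simp only [id]
    linarith
  refine h1.mono' (hg.mul continuous_cdf).aestronglyMeasurable (Eventually.of_forall fun t => ?_)
  rw [norm_mul, Real.norm_of_nonneg (cdf_pos t).le]
  exact mul_le_of_le_one_left (cdf_pos t).le (hb t)

theorem abs_integral_Iic_mul_cdf_le {g : ℝ → ℝ} (hb : ∀ x, |g x| ≤ 1) (x : ℝ) :
    |∫ t in Iic x, g t * cdf t| ≤ cdfInt x := by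
  have hc : IntegrableOn cdf (Iic x) := by
    simpa using integrableOn_Iic_mul_cdf (g := fun _ => 1) continuous_const (by simp) x
  have h := integral_Iic_of_hasDerivAt_of_tendsto' (a := x) (fun y _ => hasDerivAt_cdfInt y) hc
    tendsto_cdfInt_atBot
  rw [sub_zero] at h
  rw [← h, ← Real.norm_eq_abs]
  refine norm_integral_le_of_norm_le hc (Eventually.of_forall fun t => ?_)
  rw [norm_mul, Real.norm_of_nonneg (cdf_pos t).le]
  exact mul_le_of_le_one_left (cdf_pos t).le (hb t)

theorem cdfInt_sub_cdfInt_neg (x : ℝ) : cdfInt x - cdfInt (-x) = x := by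
  have := cdf_add_cdf_neg x
  simp only [cdfInt, pdf_neg]
  linear_combination x * this

theorem cdf_neg_mul_cdfInt_add (x : ℝ) :
    cdf (-x) * cdfInt x + cdf x * cdfInt (-x) = pdf x := by
  have := cdf_add_cdf_neg x
  simp only [cdfInt, pdf_neg]
  linear_combination pdf x * this

theorem hasDerivAt_cdf_comp_neg (x : ℝ) : HasDerivAt (fun y => cdf (-y)) (-pdf x) x := by
  simpa [Function.comp_def] using (hasDerivAt_cdf (-x)).comp x (hasDerivAt_neg x)

theorem hasDerivAt_cdfInt_comp_neg (x : ℝ) :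
    HasDerivAt (fun y => cdfInt (-y)) (-cdf (-x)) x := by
  simpa [Function.comp_def] using (hasDerivAt_cdfInt (-x)).comp x (hasDerivAt_neg x)

/-- At a local minimum the second derivative is nonnegative. -/
theorem nonneg_of_isLocalMin_of_hasDerivAt {f f' : ℝ → ℝ} {f'' x : ℝ}
    (hf : ∀ y, HasDerivAt f (f' y) y) (hf' : HasDerivAt f' f'' x) (hx : IsLocalMin f x) :
    0 ≤ f'' := by
  have h1 : deriv f = f' := funext fun y => (hf y).deriv
  by_contra! hneg
  have hmax : IsLocalMax f x := isLocalMax_of_deriv_deriv_neg (by rwa [h1, hf'.deriv])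
    (hx.deriv_eq_zero) (hf x).continuousAt
  have heq : f =ᶠ[𝓝 x] fun _ => f x := by
    filter_upwards [hx, hmax] with y h2 h3 using le_antisymm h3 h2
  have h4 := heq.deriv.deriv_eq
  rw [h1, hf'.deriv] at h4
  simp at h4
  linarith

/-- Half of the value that bounds the derivative of the solution of Stein's equation at `x`. -/
noncomputable def slopeBound (x : ℝ) : ℝ := cdfInt x * cdfInt (-x) / pdf x

theorem slopeBound_pos (x : ℝ) : 0 < slopeBound x :=
  div_pos (mul_pos (cdfInt_pos x) (cdfInt_pos (-x))) (pdf_pos x)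

@[simp] theorem slopeBound_neg (x : ℝ) : slopeBound (-x) = slopeBound x := by
  simp [slopeBound, mul_comm]

theorem slopeBound_zero : slopeBound 0 = pdf 0 := by
  have := (pdf_pos 0).ne'
  simp [slopeBound, cdfInt]

theorem mul_slopeBound_le_one (x : ℝ) : x * slopeBound x ≤ 1 := by
  rw [slopeBound, ← mul_div_assoc, div_le_one (pdf_pos x)]
  have h1 := mills_lower_bound (-x)
  have h2 : x * cdfInt (-x) ≤ cdf (-x) := by
    simp only [cdfInt, pdf_neg] at h1 ⊢
    linarith
  have h3 := mul_le_mul_of_nonneg_left h2 (cdfInt_pos x).le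
  have h4 := mul_pos (cdf_pos x) (cdfInt_pos (-x))
  linarith [cdf_neg_mul_cdfInt_add x]

/-- The derivative of `slopeBound`. -/
noncomputable def slopeBoundDeriv (x : ℝ) : ℝ :=
  (cdf x * cdfInt (-x) - cdf (-x) * cdfInt x + x * (cdfInt x * cdfInt (-x))) / pdf x

theorem hasDerivAt_slopeBound (x : ℝ) : HasDerivAt slopeBound (slopeBoundDeriv x) x := by
  have hp := (pdf_pos x).ne'
  convert! ((hasDerivAt_cdfInt x).mul (hasDerivAt_cdfInt_comp_neg x)).div (hasDerivAt_pdf x) hp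
    using 1
  rw [slopeBoundDeriv]
  simp only [Pi.mul_apply]
  field_simp
  ring

theorem continuous_slopeBound : Continuous slopeBound :=
  continuous_iff_continuousAt.2 fun x => (hasDerivAt_slopeBound x).continuousAt

/-- The second derivative of `slopeBound` at a critical point. -/
theorem hasDerivAt_slopeBoundDeriv {x : ℝ} (hx : slopeBoundDeriv x = 0) :
    HasDerivAt slopeBoundDeriv (((6 + x ^ 2) * slopeBound x ^ 2 - 1) / (2 * slopeBound x)) x := by
  have hp := (pdf_pos x).ne'
  have hI := (cdfInt_pos x).ne'
  have hJ := (cdfInt_pos (-x)).ne'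
  have hcrit : cdf x * cdfInt (-x) - cdf (-x) * cdfInt x + x * (cdfInt x * cdfInt (-x)) = 0 := by
    simpa [slopeBoundDeriv, hp] using hx
  convert! ((((hasDerivAt_cdf x).mul (hasDerivAt_cdfInt_comp_neg x)).sub
    ((hasDerivAt_cdf_comp_neg x).mul (hasDerivAt_cdfInt x))).add
    ((hasDerivAt_id x).mul ((hasDerivAt_cdfInt x).mul (hasDerivAt_cdfInt_comp_neg x)))).div
    (hasDerivAt_pdf x) hp using 1
  have e1 := cdf_neg_mul_cdfInt_add x
  have e2 := cdfInt_sub_cdfInt_neg x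
  have e3 := cdf_add_cdf_neg x
  simp only [Pi.mul_apply, Pi.add_apply, Pi.sub_apply, id, slopeBound]
  generalize cdf x = a at *
  generalize cdf (-x) = b at *
  generalize cdfInt x = I at *
  generalize cdfInt (-x) = J at *
  generalize pdf x = p at *
  have ha : a = (p - x * (I * J)) / (2 * J) := by field_simp; linear_combination e1 + hcrit
  have hb : b = (p + x * (I * J)) / (2 * I) := by field_simp; linear_combination e1 - hcrit
  have e4 : p * (I + J) = 2 * (I * J) + x ^ 2 * (I * J) := by
    rw [ha, hb] at e3
    field_simp at e3
    subst e2
    linear_combination e3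
  rw [hcrit, ha, hb]
  field_simp
  linear_combination -(4 * I * J) * e4

theorem slopeBound_le (x : ℝ) : slopeBound x ≤ pdf 0 := by
  rw [← slopeBound_zero]
  by_contra! hx
  have h0 := slopeBound_pos 0
  set X := max |x| (slopeBound 0)⁻¹ with hX
  have hX0 : 0 < X := lt_max_of_lt_right (inv_pos.2 h0)
  have hend : slopeBound X ≤ slopeBound 0 := by
    have h1 := mul_slopeBound_le_one X
    have h2 : 1 ≤ X * slopeBound 0 := by
      have := mul_le_mul_of_nonneg_right (le_max_right |x| (slopeBound 0)⁻¹) h0.le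
      rwa [inv_mul_cancel₀ h0.ne'] at this
    exact le_of_mul_le_mul_left (h1.trans h2) hX0
  have hcrit {y : ℝ} (hy : slopeBoundDeriv y = 0) := hasDerivAt_slopeBoundDeriv hy
  -- a maximiser of `slopeBound` is a nonzero critical point
  obtain ⟨z, hz, hmax⟩ := (isCompact_Icc (a := -X) (b := X)).exists_isMaxOn
    ⟨0, by constructor <;> linarith⟩ continuous_slopeBound.continuousOn
  have hz0 : slopeBound 0 < slopeBound z :=
    hx.trans_le (hmax (abs_le.1 (le_max_left |x| (slopeBound 0)⁻¹)))
  have hzX : z ∈ Ioo (-X) X := by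
    refine ⟨hz.1.lt_of_ne ?_, hz.2.lt_of_ne ?_⟩
    · rintro rfl
      rw [slopeBound_neg] at hz0
      linarith
    · rintro h
      rw [h] at hz0
      linarith
  have hzmax : IsLocalMax slopeBound z := hmax.isLocalMax (Icc_mem_nhds hzX.1 hzX.2)
  have hz1 : slopeBoundDeriv z = 0 := hzmax.hasDerivAt_eq_zero (hasDerivAt_slopeBound z)
  have hz2 : (6 + z ^ 2) * slopeBound z ^ 2 ≤ 1 := by
    have h := nonneg_of_isLocalMin_of_hasDerivAt (fun y => (hasDerivAt_slopeBound y).neg)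
      (hcrit hz1).neg hzmax.neg
    have hp := slopeBound_pos z
    rw [← neg_div, le_div_iff₀ (by linarith)] at h
    linarith
  -- a minimiser between `-|z|` and `|z|`
  have hzabs : slopeBound |z| = slopeBound z := by rcases abs_choice z with h | h <;> simp [h]
  obtain ⟨y, hy, hmin⟩ := (isCompact_Icc (a := -|z|) (b := |z|)).exists_isMinOn
    ⟨0, by simp⟩ continuous_slopeBound.continuousOn
  have hyz : slopeBound y < slopeBound z := (hmin ⟨by simp, by simp⟩).trans_lt hz0
  have hyI : y ∈ Ioo (-|z|) |z| := by
    refine ⟨hy.1.lt_of_ne ?_, hy.2.lt_of_ne ?_⟩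
    · rintro rfl
      rw [slopeBound_neg, hzabs] at hyz
      linarith
    · rintro rfl
      linarith
  have hymin : IsLocalMin slopeBound y := hmin.isLocalMin (Icc_mem_nhds hyI.1 hyI.2)
  have hy1 : slopeBoundDeriv y = 0 := hymin.hasDerivAt_eq_zero (hasDerivAt_slopeBound y)
  have hp := slopeBound_pos y
  have hy2 : 1 ≤ (6 + y ^ 2) * slopeBound y ^ 2 := by
    have h := nonneg_of_isLocalMin_of_hasDerivAt hasDerivAt_slopeBound (hcrit hy1) hymin
    rw [le_div_iff₀ (by linarith)] at h
    linarith
  have hsq : y ^ 2 < z ^ 2 := sq_lt_sq' hyI.1 hyI.2 |>.trans_eq (sq_abs z)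
  have : (6 + y ^ 2) * slopeBound y ^ 2 < (6 + z ^ 2) * slopeBound z ^ 2 := by gcongr
  linarith

/-- The integral of `g * cdf` over `(-∞, x]`. -/
noncomputable def leftPart (g : ℝ → ℝ) (x : ℝ) : ℝ := ∫ t in Iic x, g t * cdf t

/-- The integral of `g t * cdf (-t)` over `[x, ∞)`. -/
noncomputable def rightPart (g : ℝ → ℝ) (x : ℝ) : ℝ := leftPart (fun t => g (-t)) (-x)

/-- The bounded solution of Stein's equation whose right-hand side has derivative `g`. -/
noncomputable def steinSol (g : ℝ → ℝ) (x : ℝ) : ℝ :=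
  -((cdf (-x) * leftPart g x + cdf x * rightPart g x) / pdf x)

/-- The derivative of `steinSol g`. -/
noncomputable def steinSolDeriv (g : ℝ → ℝ) (x : ℝ) : ℝ :=
  (cdfInt (-x) * leftPart g x - cdfInt x * rightPart g x) / pdf x

theorem hasDerivAt_leftPart {g : ℝ → ℝ} (hg : Continuous g) (hb : ∀ x, |g x| ≤ 1) (x : ℝ) :
    HasDerivAt (leftPart g) (g x * cdf x) x :=
  hasDerivAt_integral_Iic (hg.mul continuous_cdf) (integrableOn_Iic_mul_cdf hg hb) x

theorem hasDerivAt_rightPart {g : ℝ → ℝ} (hg : Continuous g) (hb : ∀ x, |g x| ≤ 1) (x : ℝ) :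
    HasDerivAt (rightPart g) (-(g x * cdf (-x))) x := by
  convert! (hasDerivAt_leftPart (hg.comp continuous_neg) (fun t => hb (-t)) (-x)).comp x
    (hasDerivAt_neg x) using 1
  simp

theorem abs_leftPart_le {g : ℝ → ℝ} (hb : ∀ x, |g x| ≤ 1) (x : ℝ) :
    |leftPart g x| ≤ cdfInt x := abs_integral_Iic_mul_cdf_le hb x

theorem abs_rightPart_le {g : ℝ → ℝ} (hb : ∀ x, |g x| ≤ 1) (x : ℝ) :
    |rightPart g x| ≤ cdfInt (-x) :=
  abs_integral_Iic_mul_cdf_le (fun t => hb (-t)) (-x)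

theorem steinSolDeriv_sub (g : ℝ → ℝ) (x : ℝ) :
    steinSolDeriv g x - x * steinSol g x = leftPart g x - rightPart g x := by
  have hp := (pdf_pos x).ne'
  simp only [steinSol, steinSolDeriv, cdfInt, pdf_neg]
  field_simp
  ring

theorem hasDerivAt_steinSol {g : ℝ → ℝ} (hg : Continuous g) (hb : ∀ x, |g x| ≤ 1) (x : ℝ) :
    HasDerivAt (steinSol g) (steinSolDeriv g x) x := by
  have hp := (pdf_pos x).ne'
  convert! ((((hasDerivAt_cdf_comp_neg x).mul (hasDerivAt_leftPart hg hb x)).add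
    ((hasDerivAt_cdf x).mul (hasDerivAt_rightPart hg hb x))).div (hasDerivAt_pdf x) hp).neg using 1
  simp only [steinSolDeriv, cdfInt, pdf_neg, Pi.mul_apply, Pi.add_apply]
  field_simp
  ring

theorem hasDerivAt_steinSolDeriv {g : ℝ → ℝ} (hg : Continuous g) (hb : ∀ x, |g x| ≤ 1) (x : ℝ) :
    HasDerivAt (steinSolDeriv g)
    (g x - (((1 + (-x) ^ 2) * cdf (-x) + -x * pdf (-x)) * leftPart g x
      + ((1 + x ^ 2) * cdf x + x * pdf x) * rightPart g x) / pdf x) x := by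
  have hp := (pdf_pos x).ne'
  convert! (((hasDerivAt_cdfInt_comp_neg x).mul (hasDerivAt_leftPart hg hb x)).sub
    ((hasDerivAt_cdfInt x).mul (hasDerivAt_rightPart hg hb x))).div (hasDerivAt_pdf x) hp using 1
  have e := cdf_neg_mul_cdfInt_add x
  simp only [cdfInt, pdf_neg, Pi.mul_apply, Pi.sub_apply] at e ⊢
  field_simp
  linear_combination -(g x) * e

theorem abs_weighted_sum_div_pdf_le {g : ℝ → ℝ} (hb : ∀ x, |g x| ≤ 1) (x : ℝ) {a b : ℝ}
    (ha : 0 ≤ a) (hb' : 0 ≤ b) :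
    |(a * leftPart g x + b * rightPart g x) / pdf x|
      ≤ (a * cdfInt x + b * cdfInt (-x)) / pdf x := by
  rw [abs_div, abs_of_pos (pdf_pos x)]
  refine div_le_div_of_nonneg_right ((abs_add_le _ _).trans (add_le_add ?_ ?_)) (pdf_pos x).le
  · rw [abs_mul, abs_of_nonneg ha]
    exact mul_le_mul_of_nonneg_left (abs_leftPart_le hb x) ha
  · rw [abs_mul, abs_of_nonneg hb']
    exact mul_le_mul_of_nonneg_left (abs_rightPart_le hb x) hb'

theorem abs_steinSol_le {g : ℝ → ℝ} (hb : ∀ x, |g x| ≤ 1) (x : ℝ) : |steinSol g x| ≤ 1 := by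
  rw [steinSol, abs_neg]
  refine (abs_weighted_sum_div_pdf_le hb x (cdf_pos (-x)).le (cdf_pos x).le).trans_eq ?_
  rw [cdf_neg_mul_cdfInt_add, div_self (pdf_pos x).ne']

theorem abs_steinSolDeriv_le {g : ℝ → ℝ} (hb : ∀ x, |g x| ≤ 1) (x : ℝ) :
    |steinSolDeriv g x| ≤ √(2 / π) := by
  have h1 : |steinSolDeriv g x| ≤ 2 * slopeBound x := by
    rw [steinSolDeriv, slopeBound, abs_div, abs_of_pos (pdf_pos x), ← mul_div_assoc]
    refine div_le_div_of_nonneg_right ((abs_sub _ _).trans ?_) (pdf_pos x).le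
    rw [abs_mul, abs_mul, abs_of_pos (cdfInt_pos x), abs_of_pos (cdfInt_pos (-x))]
    have h2 := mul_le_mul_of_nonneg_left (abs_leftPart_le hb x) (cdfInt_pos (-x)).le
    have h3 := mul_le_mul_of_nonneg_left (abs_rightPart_le hb x) (cdfInt_pos x).le
    linarith
  refine (h1.trans (mul_le_mul_of_nonneg_left (slopeBound_le x) zero_le_two)).trans_eq ?_
  rw [pdf_eq, Real.sqrt_div zero_le_two, Real.sqrt_mul zero_le_two]
  have h2 : √(2 : ℝ) ≠ 0 := by positivity
  have h3 : √π ≠ 0 := by positivity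
  simp
  field_simp
  simp

theorem abs_steinSolDeriv_sub_le {g : ℝ → ℝ} (hg : Continuous g) (hb : ∀ x, |g x| ≤ 1)
    (x y : ℝ) : |steinSolDeriv g y - steinSolDeriv g x| ≤ 2 * |y - x| := by
  refine Convex.norm_image_sub_le_of_norm_hasDerivWithin_le (s := univ)
    (fun z _ => (hasDerivAt_steinSolDeriv hg hb z).hasDerivWithinAt) (fun z _ => ?_) convex_univ
    (mem_univ x) (mem_univ y)
  refine (norm_sub_le _ _).trans ((add_le_add (hb z) (abs_weighted_sum_div_pdf_le hb z
    (mills_lower_bound (-z)) (mills_lower_bound z))).trans_eq ?_)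
  have hp := (pdf_pos z).ne'
  have e := cdf_neg_mul_cdfInt_add z
  simp only [cdfInt, pdf_neg] at e ⊢
  field_simp
  linear_combination e

theorem integrable_comp_of_lipschitz {Ω : Type*} [MeasurableSpace Ω] {μ : Measure Ω}
    [IsProbabilityMeasure μ] {W : Ω → ℝ} (hW : Integrable W μ) {h : ℝ → ℝ}
    (hL : LipschitzWith 1 h) : Integrable (fun ω => h (W ω)) μ := by
  refine ((integrable_const |h 0|).add hW.norm).mono'
    (hL.continuous.comp_aestronglyMeasurable hW.aestronglyMeasurable)
    (Eventually.of_forall fun ω => ?_)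
  have h1 : |h (W ω) - h 0| ≤ |W ω| := by simpa [Real.dist_eq] using hL.dist_le_mul (W ω) 0
  have h2 := abs_add_le (h 0) (h (W ω) - h 0)
  rw [add_sub_cancel] at h2
  simp only [Pi.add_apply, Real.norm_eq_abs]
  linarith

theorem integrable_gaussianReal_of_lipschitz {h : ℝ → ℝ} (hL : LipschitzWith 1 h) :
    Integrable h (gaussianReal 0 1) :=
  integrable_comp_of_lipschitz ((memLp_id_gaussianReal 1).integrable le_rfl) hL

theorem steinSol_equation {h g : ℝ → ℝ} (hL : LipschitzWith 1 h) (hd : ∀ x, HasDerivAt h (g x) x)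
    (hg : Continuous g) (hb : ∀ x, |g x| ≤ 1) (x : ℝ) :
    steinSolDeriv g x - x * steinSol g x = h x - ∫ y, h y ∂(gaussianReal 0 1) := by
  obtain ⟨C, hC⟩ : ∃ C, ∀ x, steinSolDeriv g x - x * steinSol g x = h x - C := by
    have hd' (x : ℝ) : HasDerivAt (fun x => h x - (leftPart g x - rightPart g x)) 0 x := by
      convert! (hd x).sub ((hasDerivAt_leftPart hg hb x).sub (hasDerivAt_rightPart hg hb x)) using 1
      linear_combination g x * cdf_add_cdf_neg x
    refine ⟨h 0 - (leftPart g 0 - rightPart g 0), fun x => ?_⟩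
    have := is_const_of_deriv_eq_zero (fun x => (hd' x).differentiableAt) (fun x => (hd' x).deriv)
      x 0
    rw [steinSolDeriv_sub]
    linarith
  have hint : ∫ y, h y ∂(gaussianReal 0 1) = C := by
    have hi : Integrable (fun y => h y - C) (gaussianReal 0 1) :=
      (integrable_gaussianReal_of_lipschitz hL).sub (integrable_const C)
    have h0 : ∫ y, (h y - C) ∂(gaussianReal 0 1) = 0 := by
      rw [integral_gaussianReal_eq_integral_smul one_ne_zero]
      have hi' : Integrable (fun y => pdf y • (h y - C)) := by
        rw [gaussianReal_of_var_ne_zero 0 one_ne_zero, gaussianPDF_def,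
          integrable_withDensity_iff_integrable_smul₀'] at hi
        · refine hi.congr (Eventually.of_forall fun y => ?_)
          simp [pdf, ENNReal.toReal_ofReal (gaussianPDFReal_nonneg 0 1 y)]
        · exact (measurable_gaussianPDF 0 1).aemeasurable
        · exact Eventually.of_forall fun y => ENNReal.ofReal_lt_top
      have hlim {l : Filter ℝ} (hl : Tendsto pdf l (𝓝 0)) :
          Tendsto (fun y => steinSol g y * pdf y) l (𝓝 0) := by
        refine squeeze_zero_norm (fun y => ?_) hl
        rw [norm_mul, Real.norm_of_nonneg (pdf_pos y).le]
        exact mul_le_of_le_one_left (pdf_pos y).le (abs_steinSol_le hb y)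
      have := integral_of_hasDerivAt_of_tendsto (f := fun y => steinSol g y * pdf y)
        (fun y => ?_) hi' (hlim tendsto_pdf_atBot) (hlim tendsto_pdf_atTop)
      · rwa [sub_zero] at this
      · convert! (hasDerivAt_steinSol hg hb y).mul (hasDerivAt_pdf y) using 1
        rw [← hC, smul_eq_mul]
        ring
    rw [integral_sub (integrable_gaussianReal_of_lipschitz hL) (integrable_const C)] at h0
    simp at h0
    linarith
  rw [hint, hC]

/-- Second order Taylor expansion to the right of `x`. -/
theorem abs_taylor_add_le {F f g : ℝ → ℝ} (hF : ∀ x, HasDerivAt F (f x) x)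
    (hf : ∀ x, HasDerivAt f (g x) x) (hg : ∀ x y, |g y - g x| ≤ 2 * |y - x|) (x : ℝ) {t : ℝ}
    (ht : 0 ≤ t) : |F (x + t) - F x - f x * t - g x * t ^ 2 / 2| ≤ t ^ 3 / 3 := by
  have hf1 (s : ℝ) (hs : 0 ≤ s) : |f (x + s) - f x - g x * s| ≤ s ^ 2 := by
    have hd (u : ℝ) : HasDerivAt (fun u => f (x + u) - f x - g x * u) (g (x + u) - g x) u := by
      convert! (((hf (x + u)).comp_const_add x u).sub_const (f x)).sub
        ((hasDerivAt_id u).const_mul (g x)) using 1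
      simp
    refine image_norm_le_of_norm_deriv_right_le_deriv_boundary (a := 0) (b := s)
      (f := fun u => f (x + u) - f x - g x * u) (B := fun u => u ^ 2) (B' := fun u => 2 * u)
      (fun u _ => (hd u).continuousAt.continuousWithinAt) (fun u _ => (hd u).hasDerivWithinAt)
      (by simp) (fun u => by simpa using hasDerivAt_pow 2 u) (fun u hu => ?_) ⟨hs, le_rfl⟩
    have := hg x (x + u)
    rwa [add_sub_cancel_left, abs_of_nonneg hu.1] at this
  have hd (u : ℝ) : HasDerivAt (fun u => F (x + u) - F x - f x * u - g x * u ^ 2 / 2)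
      (f (x + u) - f x - g x * u) u := by
    convert! ((((hF (x + u)).comp_const_add x u).sub_const (F x)).sub
      ((hasDerivAt_id u).const_mul (f x))).sub (((hasDerivAt_pow 2 u).const_mul (g x)).div_const 2)
      using 1
    simp
    ring
  refine image_norm_le_of_norm_deriv_right_le_deriv_boundary (a := 0) (b := t)
    (f := fun u => F (x + u) - F x - f x * u - g x * u ^ 2 / 2) (B := fun u => u ^ 3 / 3)
    (B' := fun u => u ^ 2)
    (fun u _ => (hd u).continuousAt.continuousWithinAt) (fun u _ => (hd u).hasDerivWithinAt)
    (by simp) (fun u => ?_) (fun u hu => hf1 u hu.1) ⟨ht, le_rfl⟩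
  convert! (hasDerivAt_pow 3 u).div_const 3 using 1
  simp

theorem abs_taylor_le {F f g : ℝ → ℝ} (hF : ∀ x, HasDerivAt F (f x) x)
    (hf : ∀ x, HasDerivAt f (g x) x) (hg : ∀ x y, |g y - g x| ≤ 2 * |y - x|) (x y : ℝ) :
    |F y - F x - f x * (y - x) - g x * (y - x) ^ 2 / 2| ≤ |y - x| ^ 3 / 3 := by
  rcases le_total x y with h | h
  · have := abs_taylor_add_le hF hf hg x (sub_nonneg.2 h)
    rw [add_sub_cancel] at this
    rwa [abs_of_nonneg (sub_nonneg.2 h)]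
  · have := abs_taylor_add_le (F := fun u => F (-u)) (f := fun u => -f (-u))
      (g := fun u => g (-u))
      (fun u => by simpa [Function.comp_def] using (hF (-u)).comp u (hasDerivAt_neg u))
      (fun u => by convert! ((hf (-u)).comp u (hasDerivAt_neg u)).neg using 1; simp)
      (fun u v => (hg (-u) (-v)).trans_eq (by rw [← abs_neg]; congr 2; ring))
      (-x) (sub_nonneg.2 h)
    rw [abs_of_nonpos (sub_nonpos.2 h), neg_sub]
    convert! this using 2
    simp
    ring

theorem integral_comp_mul_eq_of_condExp_eq {Ω : Type*} [MeasurableSpace Ω] {μ : Measure Ω}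
    [IsProbabilityMeasure μ] {W Y Z : Ω → ℝ} (hW : Measurable W) (hY : Integrable Y μ)
    (hYZ : μ[Y | MeasurableSpace.comap W inferInstance] =ᵐ[μ] Z) {k : ℝ → ℝ}
    (hk : Continuous k) {c : ℝ} (hkc : ∀ x, |k x| ≤ c) :
    ∫ ω, k (W ω) * Y ω ∂μ = ∫ ω, k (W ω) * Z ω ∂μ := by
  have hm : MeasurableSpace.comap W inferInstance ≤ _ := hW.comap_le
  have hkW : StronglyMeasurable[MeasurableSpace.comap W inferInstance] (fun ω => k (W ω)) :=
    (hk.measurable.comp (comap_measurable W)).stronglyMeasurable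
  have h := condExp_stronglyMeasurable_mul_of_bound hm hkW hY c
    (Eventually.of_forall fun ω => hkc (W ω))
  calc ∫ ω, k (W ω) * Y ω ∂μ
      = ∫ ω, (μ[(fun ω => k (W ω)) * Y | MeasurableSpace.comap W inferInstance]) ω ∂μ :=
        (integral_condExp hm).symm
    _ = ∫ ω, k (W ω) * Z ω ∂μ := integral_congr_ae (h.trans (by
        filter_upwards [hYZ] with ω hω
        rw [Pi.mul_apply, hω]))

theorem abs_integral_comp_mul_le {Ω : Type*} [MeasurableSpace Ω] {μ : Measure Ω}
    {W R : Ω → ℝ} (hR : Integrable R μ) {k : ℝ → ℝ} {c : ℝ} (hkc : ∀ x, |k x| ≤ c) :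
    |∫ ω, k (W ω) * R ω ∂μ| ≤ c * ∫ ω, |R ω| ∂μ := by
  rw [← integral_const_mul, ← Real.norm_eq_abs]
  refine norm_integral_le_of_norm_le (hR.abs.const_mul c) (Eventually.of_forall fun ω => ?_)
  rw [norm_mul]
  exact mul_le_mul_of_nonneg_right (hkc _) (abs_nonneg _)

/-- The bound of the method of exchangeable pairs for continuously differentiable test functions.
Only the equality of the laws of `W` and `W'` is needed. -/
theorem abs_integral_sub_le_of_hasDerivAt
    {Ω : Type*} [MeasurableSpace Ω] {μ : Measure Ω} [IsProbabilityMeasure μ]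
    {W W' : Ω → ℝ} (hW : Measurable W) (hlaw : IdentDistrib W W' μ μ)
    (hthird : Integrable (fun ω => |W ω| ^ 3) μ) {lam : ℝ} (hlam : 0 < lam) {R₁ R₂ : Ω → ℝ}
    (hlin : μ[(fun ω => W' ω - W ω) | MeasurableSpace.comap W inferInstance]
      =ᵐ[μ] fun ω => -lam * (W ω + R₁ ω))
    (hquad : μ[(fun ω => (W' ω - W ω) ^ 2) | MeasurableSpace.comap W inferInstance]
      =ᵐ[μ] fun ω => 2 * lam * (1 + R₂ ω))
    {h g : ℝ → ℝ} (hL : LipschitzWith 1 h) (hd : ∀ x, HasDerivAt h (g x) x)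
    (hg : Continuous g) (hb : ∀ x, |g x| ≤ 1) :
    |(∫ ω, h (W ω) ∂μ) - ∫ x, h x ∂(gaussianReal 0 1)| ≤
      (∫ ω, |R₁ ω| ∂μ) + √(2 / π) * (∫ ω, |R₂ ω| ∂μ)
        + (1 / (3 * lam)) * ∫ ω, |W' ω - W ω| ^ 3 ∂μ := by
  have hW3 : MemLp W 3 μ := by
    rw [← integrable_norm_rpow_iff hW.aestronglyMeasurable (by norm_num) (by norm_num)]
    refine hthird.congr (Eventually.of_forall fun ω => ?_)
    norm_num
  have hW3' : MemLp W' 3 μ := hlaw.memLp_iff.1 hW3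
  have hD3 : MemLp (fun ω => W' ω - W ω) 3 μ := hW3'.sub hW3
  have hWi : Integrable W μ := hW3.integrable (by norm_num)
  have hWi' : Integrable W' μ := hW3'.integrable (by norm_num)
  have hDi : Integrable (fun ω => W' ω - W ω) μ := hWi'.sub hWi
  have hD2i : Integrable (fun ω => (W' ω - W ω) ^ 2) μ :=
    (hD3.mono_exponent (by norm_num)).integrable_sq
  have hD3i : Integrable (fun ω => |W' ω - W ω| ^ 3) μ := by
    simpa using hD3.integrable_norm_pow (p := 3) (by norm_num)
  have hR₁ : Integrable R₁ μ := by
    have h1 := ((integrable_condExp.congr hlin).const_mul (-lam)⁻¹).sub hWi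
    refine h1.congr (Eventually.of_forall fun ω => ?_)
    simp only [Pi.sub_apply]
    rw [inv_mul_cancel_left₀ (by linarith)]
    ring
  have hR₂ : Integrable R₂ μ := by
    have h1 := ((integrable_condExp.congr hquad).const_mul (2 * lam)⁻¹).sub (integrable_const 1)
    refine h1.congr (Eventually.of_forall fun ω => ?_)
    simp only [Pi.sub_apply]
    rw [inv_mul_cancel_left₀ (by linarith)]
    ring
  set f := steinSol g
  set f' := steinSolDeriv g
  have hf (x : ℝ) : HasDerivAt f (f' x) x := hasDerivAt_steinSol hg hb x
  have hfb : ∀ x, |f x| ≤ 1 := abs_steinSol_le hb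
  have hfb' : ∀ x, |f' x| ≤ √(2 / π) := abs_steinSolDeriv_le hb
  have hfc : Continuous f := continuous_iff_continuousAt.2 fun x => (hf x).continuousAt
  have hfc' : Continuous f' :=
    continuous_iff_continuousAt.2 fun x => (hasDerivAt_steinSolDeriv hg hb x).continuousAt
  set F : ℝ → ℝ := fun x => ∫ t in (0 : ℝ)..x, f t
  have hF (x : ℝ) : HasDerivAt F (f x) x :=
    intervalIntegral.integral_hasDerivAt_right (hfc.intervalIntegrable _ _)
      hfc.stronglyMeasurable.stronglyMeasurableAtFilter hfc.continuousAt
  have hFc : Continuous F := continuous_iff_continuousAt.2 fun x => (hF x).continuousAt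
  have hFb (x : ℝ) : ‖F x‖ ≤ ‖x‖ := by
    have := intervalIntegral.norm_integral_le_of_norm_le_const (a := 0) (b := x) (f := f) (C := 1)
      fun y _ => hfb y
    simpa using this
  have hFi : Integrable (fun ω => F (W ω)) μ :=
    hWi.mono (hFc.measurable.comp hW).aestronglyMeasurable (Eventually.of_forall fun ω => hFb _)
  have hlawF := hlaw.comp hFc.measurable
  have hFi' : Integrable (fun ω => F (W' ω)) μ := hlawF.integrable_iff.1 hFi
  have hFeq : ∫ ω, F (W ω) ∂μ = ∫ ω, F (W' ω) ∂μ := hlawF.integral_eq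
  have hbdd {k : ℝ → ℝ} (hk : Continuous k) {c : ℝ} (hkc : ∀ x, |k x| ≤ c) {Y : Ω → ℝ}
      (hY : Integrable Y μ) : Integrable (fun ω => k (W ω) * Y ω) μ :=
    hY.bdd_mul (hk.measurable.comp hW).aestronglyMeasurable
      (Eventually.of_forall fun ω => hkc (W ω))
  have i1 := hbdd hfc hfb hDi
  have i2 := hbdd hfc' hfb' hD2i
  have i3 := hbdd hfc hfb hWi
  have i4 := hbdd hfc hfb hR₁
  have i5 : Integrable (fun ω => f' (W ω)) μ := by
    simpa using hbdd hfc' hfb' (integrable_const (μ := μ) (1 : ℝ))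
  have i6 := hbdd hfc' hfb' hR₂
  have e1 : ∫ ω, f (W ω) * (W' ω - W ω) ∂μ
      = -lam * ((∫ ω, f (W ω) * W ω ∂μ) + ∫ ω, f (W ω) * R₁ ω ∂μ) := by
    rw [integral_comp_mul_eq_of_condExp_eq hW hDi hlin hfc hfb, ← integral_add i3 i4,
      ← integral_const_mul]
    exact integral_congr_ae (Eventually.of_forall fun ω => by ring)
  have e2 : ∫ ω, f' (W ω) * (W' ω - W ω) ^ 2 ∂μ
      = 2 * lam * ((∫ ω, f' (W ω) ∂μ) + ∫ ω, f' (W ω) * R₂ ω ∂μ) := by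
    rw [integral_comp_mul_eq_of_condExp_eq hW hD2i hquad hfc' hfb', ← integral_add i5 i6,
      ← integral_const_mul]
    exact integral_congr_ae (Eventually.of_forall fun ω => by ring)
  have e3 : |(∫ ω, f (W ω) * (W' ω - W ω) ∂μ) + (∫ ω, f' (W ω) * (W' ω - W ω) ^ 2 ∂μ) / 2|
      ≤ (∫ ω, |W' ω - W ω| ^ 3 ∂μ) / 3 := by
    have h1 : ∫ ω, (F (W' ω) - F (W ω) - f (W ω) * (W' ω - W ω)
          - f' (W ω) * (W' ω - W ω) ^ 2 / 2) ∂μ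
        = -((∫ ω, f (W ω) * (W' ω - W ω) ∂μ)
          + (∫ ω, f' (W ω) * (W' ω - W ω) ^ 2 ∂μ) / 2) := by
      have j1 : Integrable (fun ω => F (W' ω) - F (W ω)) μ := hFi'.sub hFi
      have j2 : Integrable (fun ω => F (W' ω) - F (W ω) - f (W ω) * (W' ω - W ω)) μ := j1.sub i1
      rw [integral_sub j2 (i2.div_const 2), integral_sub j1 i1,
        integral_sub hFi' hFi, hFeq, integral_div]
      ring
    rw [← abs_neg, ← h1, ← integral_div, ← Real.norm_eq_abs]
    exact norm_integral_le_of_norm_le (hD3i.div_const 3)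
      (Eventually.of_forall fun ω => abs_taylor_le hF hf (abs_steinSolDeriv_sub_le hg hb) _ _)
  have e4 : (∫ ω, h (W ω) ∂μ) - ∫ x, h x ∂(gaussianReal 0 1)
      = (∫ ω, f' (W ω) ∂μ) - ∫ ω, f (W ω) * W ω ∂μ := by
    have h1 (ω : Ω) : h (W ω) = (f' (W ω) - f (W ω) * W ω) + ∫ x, h x ∂(gaussianReal 0 1) := by
      have := steinSol_equation hL hd hg hb (W ω)
      simp only [f, f']
      linarith
    simp_rw [h1]
    have j1 : Integrable (fun ω => f' (W ω) - f (W ω) * W ω) μ := i5.sub i3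
    rw [integral_add j1 (integrable_const _), integral_sub i5 i3]
    simp
  have b1 := abs_integral_comp_mul_le (W := W) hR₁ hfb
  have b2 := abs_integral_comp_mul_le (W := W) hR₂ hfb'
  rw [e1, e2, show ∀ a b c d : ℝ, -lam * (a + b) + 2 * lam * (c + d) / 2
    = lam * (c - a - b + d) by intros; ring, abs_mul, abs_of_pos hlam] at e3
  have b3 : |(∫ ω, f' (W ω) ∂μ) - (∫ ω, f (W ω) * W ω ∂μ) - (∫ ω, f (W ω) * R₁ ω ∂μ)
      + ∫ ω, f' (W ω) * R₂ ω ∂μ| ≤ (1 / (3 * lam)) * ∫ ω, |W' ω - W ω| ^ 3 ∂μ := by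
    rw [one_div_mul_eq_div, le_div_iff₀ (by linarith)]
    linarith
  rw [e4, abs_le]
  rw [abs_le] at b1 b2 b3
  constructor <;> linarith

/-- A Lipschitz function is a uniform limit of continuously differentiable Lipschitz functions. -/
theorem exists_hasDerivAt_approx {h : ℝ → ℝ} (hL : LipschitzWith 1 h) {ε : ℝ} (hε : 0 < ε) :
    ∃ k g : ℝ → ℝ, LipschitzWith 1 k ∧ (∀ x, HasDerivAt k (g x) x) ∧ Continuous g ∧
      (∀ x, |g x| ≤ 1) ∧ ∀ x, |h x - k x| ≤ ε := by
  have hc := hL.continuous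
  have hlip (x y : ℝ) : |h x - h y| ≤ |x - y| := by simpa [Real.dist_eq] using hL.dist_le_mul x y
  have hd (x : ℝ) : HasDerivAt (fun x => (∫ t in x..x + ε, h t) / ε) ((h (x + ε) - h x) / ε) x := by
    have h0 (y : ℝ) : HasDerivAt (fun y => ∫ t in (0 : ℝ)..y, h t) (h y) y :=
      intervalIntegral.integral_hasDerivAt_right (hc.intervalIntegrable _ _)
        hc.stronglyMeasurable.stronglyMeasurableAtFilter hc.continuousAt
    convert! (((h0 (x + ε)).comp_add_const x ε).sub (h0 x)).div_const ε using 2 with y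
    rw [Pi.sub_apply, intervalIntegral.integral_interval_sub_left (hc.intervalIntegrable _ _)
      (hc.intervalIntegrable _ _)]
  have hb (x : ℝ) : |(h (x + ε) - h x) / ε| ≤ 1 := by
    rw [abs_div, abs_of_pos hε, div_le_one hε]
    simpa [abs_of_pos hε] using hlip (x + ε) x
  refine ⟨_, _, ?_, hd, by fun_prop, hb, fun x => ?_⟩
  · exact lipschitzWith_of_nnnorm_deriv_le (fun x => (hd x).differentiableAt)
      fun x => by rw [(hd x).deriv]; exact hb x
  · have h1 : h x - (∫ t in x..x + ε, h t) / ε = (∫ t in x..x + ε, (h x - h t)) / ε := by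
      rw [intervalIntegral.integral_sub (by simp) (hc.intervalIntegrable _ _)]
      simp
      field_simp
    rw [h1, abs_div, abs_of_pos hε, div_le_iff₀ hε]
    have := intervalIntegral.norm_integral_le_of_norm_le_const (a := x) (b := x + ε)
      (f := fun t => h x - h t) (C := ε) fun t ht => by
        rw [uIoc_of_le (by linarith)] at ht
        refine (hlip x t).trans ?_
        rw [abs_le]
        constructor <;> linarith [ht.1, ht.2]
    simpa [abs_of_pos hε] using this

theorem abs_integral_sub_integral_le {α : Type*} [MeasurableSpace α] {μ : Measure α}
    [IsProbabilityMeasure μ] {u v : α → ℝ} (hu : Integrable u μ) (hv : Integrable v μ) {ε : ℝ}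
    (h : ∀ x, |u x - v x| ≤ ε) : |(∫ x, u x ∂μ) - ∫ x, v x ∂μ| ≤ ε := by
  rw [← integral_sub hu hv, ← Real.norm_eq_abs]
  simpa using norm_integral_le_of_norm_le_const (μ := μ) (f := fun x => u x - v x)
    (Eventually.of_forall h)

end SteinNormal

/-- Stein's method of exchangeable pairs: Wasserstein bound for normal approximation. -/
theorem stein_exchangeable_pairs
    {Ω : Type*} [MeasurableSpace Ω] (μ : Measure Ω) [IsProbabilityMeasure μ]
    (W W' : Ω → ℝ) (hW : Measurable W) (hW' : Measurable W')
    (hexch : Measure.map (fun ω => (W ω, W' ω)) μ = Measure.map (fun ω => (W' ω, W ω)) μ)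
    (hmean : ∫ ω, W ω ∂μ = 0) (hsecond : ∫ ω, (W ω) ^ 2 ∂μ = 1)
    (hthird : Integrable (fun ω => |W ω| ^ 3) μ)
    (lam : ℝ) (hlam : lam ∈ Set.Ioo (0 : ℝ) 1)
    (R₁ R₂ : Ω → ℝ)
    (hR₁ : Measurable[MeasurableSpace.comap W inferInstance] R₁)
    (hR₂ : Measurable[MeasurableSpace.comap W inferInstance] R₂)
    (hlin : μ[(fun ω => W' ω - W ω) | MeasurableSpace.comap W inferInstance]
      =ᵐ[μ] fun ω => -lam * (W ω + R₁ ω))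
    (hquad : μ[(fun ω => (W' ω - W ω) ^ 2) | MeasurableSpace.comap W inferInstance]
      =ᵐ[μ] fun ω => 2 * lam * (1 + R₂ ω)) :
    ∀ h : ℝ → ℝ, LipschitzWith 1 h →
      |(∫ ω, h (W ω) ∂μ) - ∫ x, h x ∂(gaussianReal 0 1)| ≤
        (∫ ω, |R₁ ω| ∂μ) + Real.sqrt (2 / π) * (∫ ω, |R₂ ω| ∂μ)
          + (1 / (3 * lam)) * ∫ ω, |W' ω - W ω| ^ 3 ∂μ := by
  intro h hL
  have hlaw : IdentDistrib W W' μ μ := by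
    refine ⟨hW.aemeasurable, hW'.aemeasurable, ?_⟩
    have h1 := congrArg (Measure.map Prod.fst) hexch
    rwa [Measure.map_map measurable_fst (hW.prodMk hW'),
      Measure.map_map measurable_fst (hW'.prodMk hW)] at h1
  have hWi : Integrable W μ := by
    refine ((integrable_const (1 : ℝ)).add hthird).mono' hW.aestronglyMeasurable
      (Filter.Eventually.of_forall fun ω => ?_)
    simp only [Pi.add_apply, Real.norm_eq_abs]
    nlinarith [abs_nonneg (W ω), mul_nonneg (abs_nonneg (W ω)) (sq_nonneg (|W ω| - 1))]
  refine le_of_forall_pos_le_add fun ε hε => ?_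
  obtain ⟨k, g, hkL, hd, hg, hb, hk⟩ := SteinNormal.exists_hasDerivAt_approx hL (half_pos hε)
  have h1 := SteinNormal.abs_integral_sub_le_of_hasDerivAt hW hlaw hthird hlam.1 hlin hquad
    hkL hd hg hb
  have h2 := SteinNormal.abs_integral_sub_integral_le
    (SteinNormal.integrable_comp_of_lipschitz hWi hL)
    (SteinNormal.integrable_comp_of_lipschitz hWi hkL) fun ω => hk (W ω)
  have h3 := SteinNormal.abs_integral_sub_integral_le
    (SteinNormal.integrable_gaussianReal_of_lipschitz hL)
    (SteinNormal.integrable_gaussianReal_of_lipschitz hkL) hk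
  rw [abs_le] at h1 h2 h3 ⊢
  constructor <;> linarith
end

section
/- Let ω be a random variable on a probability space taking values in the open interval (0,1), and let k ≥ 1 be an integer. Then |log E[(1−ω)^k] + k·E[ω]| ≤ max{ k(k−1)/2 , k/(1 − E[ω]) } · E[ω²]. -/
open MeasureTheory

lemma one_sub_pow_le_quadratic {x : ℝ} (h0 : 0 ≤ x) (h1 : x ≤ 1) (k : ℕ) :
    (1 - x) ^ k ≤ 1 - k * x + (k : ℝ) * ((k : ℝ) - 1) / 2 * x ^ 2 := by
  induction k with
  | zero => simp
  | succ n ih =>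
    have hn : (0 : ℝ) ≤ (n : ℝ) * ((n : ℝ) - 1) / 2 := by
      rcases Nat.eq_zero_or_pos n with rfl | h
      · simp
      · have : (1 : ℝ) ≤ n := by exact_mod_cast h
        have : (0 : ℝ) ≤ (n : ℝ) - 1 := by linarith
        positivity
    have h2 := mul_le_mul_of_nonneg_right ih (sub_nonneg.2 h1)
    have h3 : 0 ≤ (n : ℝ) * ((n : ℝ) - 1) / 2 * x ^ 3 := by positivity
    rw [pow_succ]
    push_cast
    linarith

lemma pow_integral_le_integral_pow {Ω : Type*} [MeasurableSpace Ω] {μ : Measure Ω}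
    [IsProbabilityMeasure μ] {f : Ω → ℝ} (hf : ∀ᵐ ω ∂μ, 0 ≤ f ω) (n : ℕ)
    (hfi : Integrable f μ) (hfn : Integrable (fun ω => f ω ^ n) μ) :
    (∫ ω, f ω ∂μ) ^ n ≤ ∫ ω, f ω ^ n ∂μ :=
  (convexOn_pow n).map_integral_le (continuous_pow n).continuousOn isClosed_Ici hf hfi hfn

/-- For a random variable `ω` supported on `(0,1)` and `k ≥ 1`,
`|log E(1-ω)^k + k·Eω| ≤ max{k(k-1)/2, k/(1-Eω)} · Eω²`. -/
theorem log_moment_bound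
    {Ω : Type*} [MeasurableSpace Ω] (μ : Measure Ω) [IsProbabilityMeasure μ]
    (X : Ω → ℝ) (hXm : Measurable X) (hX : ∀ᵐ ω ∂μ, X ω ∈ Set.Ioo (0 : ℝ) 1)
    (k : ℕ) (hk : 1 ≤ k) :
    |Real.log (∫ ω, (1 - X ω) ^ k ∂μ) + (k : ℝ) * ∫ ω, X ω ∂μ| ≤
      max ((k : ℝ) * ((k : ℝ) - 1) / 2) ((k : ℝ) / (1 - ∫ ω, X ω ∂μ)) *
        ∫ ω, (X ω) ^ 2 ∂μ := by
  have hXi : Integrable X μ := by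
    refine Integrable.of_bound hXm.aestronglyMeasurable 1 ?_
    filter_upwards [hX] with ω h
    rw [Real.norm_of_nonneg h.1.le]
    exact h.2.le
  have hX2 : Integrable (fun ω => X ω ^ 2) μ := by
    refine Integrable.of_bound (hXm.pow_const 2).aestronglyMeasurable 1 ?_
    filter_upwards [hX] with ω h
    rw [Real.norm_of_nonneg (by positivity)]
    exact pow_le_one₀ h.1.le h.2.le
  have hYi : Integrable (fun ω => 1 - X ω) μ := (integrable_const 1).sub hXi
  have hYk : Integrable (fun ω => (1 - X ω) ^ k) μ := by
    refine Integrable.of_bound ((hXm.const_sub 1).pow_const k).aestronglyMeasurable 1 ?_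
    filter_upwards [hX] with ω h
    have h1 : 0 ≤ 1 - X ω := by linarith [h.2]
    rw [Real.norm_of_nonneg (by positivity)]
    exact pow_le_one₀ h1 (by linarith [h.1])
  have hYm : ∫ ω, (1 - X ω) ∂μ = 1 - ∫ ω, X ω ∂μ := by
    rw [integral_sub (integrable_const 1) hXi]
    simp
  have hm1 : 0 < 1 - ∫ ω, X ω ∂μ := by
    rw [← hYm, integral_pos_iff_support_of_nonneg_ae _ hYi]
    · have : (Function.support fun ω => 1 - X ω) ∈ ae μ := by
        filter_upwards [hX] with ω h
        exact (sub_pos.2 h.2).ne'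
      rw [measure_congr (Filter.eventuallyEq_univ.2 this)]
      simp
    · filter_upwards [hX] with ω h
      exact (sub_pos.2 h.2).le
  have hsq := pow_integral_le_integral_pow (hX.mono fun ω h => h.1.le) 2 hXi hX2
  have hjensen := pow_integral_le_integral_pow (hX.mono fun ω h => (sub_pos.2 h.2).le) k hYi hYk
  rw [hYm] at hjensen
  have hupper : ∫ ω, (1 - X ω) ^ k ∂μ ≤
      1 - k * ∫ ω, X ω ∂μ + (k : ℝ) * ((k : ℝ) - 1) / 2 * ∫ ω, X ω ^ 2 ∂μ := by
    have hlin : Integrable (fun ω => 1 - k * X ω) μ := (integrable_const 1).sub (hXi.const_mul _)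
    have hquad : Integrable (fun ω => (k : ℝ) * ((k : ℝ) - 1) / 2 * X ω ^ 2) μ :=
      hX2.const_mul _
    calc ∫ ω, (1 - X ω) ^ k ∂μ
        ≤ ∫ ω, (1 - k * X ω + (k : ℝ) * ((k : ℝ) - 1) / 2 * X ω ^ 2) ∂μ :=
          integral_mono_ae hYk (hlin.add hquad)
            (hX.mono fun ω h => one_sub_pow_le_quadratic h.1.le h.2.le k)
      _ = _ := by
          rw [integral_add hlin hquad, integral_sub (integrable_const 1) (hXi.const_mul _),
            integral_const_mul, integral_const_mul]
          simp
  set m := ∫ ω, X ω ∂μ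
  set s := ∫ ω, X ω ^ 2 ∂μ
  have hs : 0 ≤ s := (sq_nonneg m).trans hsq
  have hpos : 0 < (1 - m) ^ k := pow_pos hm1 k
  rw [abs_le]
  constructor
  · have hlog := Real.log_le_log hpos hjensen
    rw [Real.log_pow] at hlog
    have hinv := mul_le_mul_of_nonneg_left (Real.one_sub_inv_le_log_of_pos hm1)
      (Nat.cast_nonneg (α := ℝ) k)
    have hid : (k : ℝ) * (1 - (1 - m)⁻¹) + k * m = -(k / (1 - m) * m ^ 2) := by
      field_simp
      ring
    have hle : (k : ℝ) / (1 - m) * m ^ 2 ≤ k / (1 - m) * s := by gcongr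
    have hmax := mul_le_mul_of_nonneg_right
      (le_max_right ((k : ℝ) * ((k : ℝ) - 1) / 2) (k / (1 - m))) hs
    linarith
  · have hlog := Real.log_le_sub_one_of_pos (hpos.trans_le hjensen)
    have hmax := mul_le_mul_of_nonneg_right
      (le_max_left ((k : ℝ) * ((k : ℝ) - 1) / 2) (k / (1 - m))) hs
    linarith
end

section
/- Fix an integer m ≥ 2 and a real δ > −m, and for 2 ≤ i < j define Q(i,j) := E[ψ_i²] · ∏_{t=i+1}^{j−1} E[(1−ψ_t)²], where the moments are given by the explicit Gamma-ratio formulas for Beta moments. Then there exists a constant C > 0, depending only on m and δ, such that for all integers 2 ≤ i < j: | Q(i,j) · i² · (j/i)^{2β} · (2m+δ)² / ((m+δ)(m+δ+1)) − 1 | ≤ C/i. In particular Q(i,j) is bounded above and below by constant multiples of i^{2β−2} j^{−2β}. -/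
open Real

/-- `E ψ_i²` for `ψ_i ~ Beta(m+δ, (2m+δ)(i-1)-m)`, via the Gamma-ratio formula. -/
noncomputable def Epsi2 (m : ℕ) (δ : ℝ) (i : ℕ) : ℝ :=
  Real.Gamma ((m : ℝ) + δ + 2) / Real.Gamma ((m : ℝ) + δ) *
    (Real.Gamma ((2 * (m : ℝ) + δ) * i - 2 * m) /
      Real.Gamma ((2 * (m : ℝ) + δ) * i - 2 * m + 2))

/-- `E (1-ψ_t)²` for `ψ_t ~ Beta(m+δ, (2m+δ)(t-1)-m)`, via the Gamma-ratio formula. -/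
noncomputable def EOneSubPsi2 (m : ℕ) (δ : ℝ) (t : ℕ) : ℝ :=
  Real.Gamma ((2 * (m : ℝ) + δ) * ((t : ℝ) - 1) - m + 2) /
    Real.Gamma ((2 * (m : ℝ) + δ) * ((t : ℝ) - 1) - m) *
    (Real.Gamma ((2 * (m : ℝ) + δ) * t - 2 * m) /
      Real.Gamma ((2 * (m : ℝ) + δ) * t - 2 * m + 2))

/-- `Q(i,j) = E ψ_i² · ∏_{t=i+1}^{j-1} E (1-ψ_t)²`, the second moment `‖θ_{ij}‖₂²`. -/
noncomputable def Qedge (m : ℕ) (δ : ℝ) (i j : ℕ) : ℝ :=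
  Epsi2 m δ i * ∏ t ∈ Finset.Ico (i + 1) j, EOneSubPsi2 m δ t



theorem Real.Gamma_add_two_div {s : ℝ} (hs : 0 < s) :
    Real.Gamma (s + 2) / Real.Gamma s = s * (s + 1) := by
  have h0 := (Real.Gamma_pos_of_pos hs).ne'
  rw [show s + 2 = (s + 1) + 1 by ring, Real.Gamma_add_one (by linarith),
    Real.Gamma_add_one hs.ne']
  field_simp

theorem Real.Gamma_div_add_two {s : ℝ} (hs : 0 < s) :
    Real.Gamma s / Real.Gamma (s + 2) = (s * (s + 1))⁻¹ := by
  rw [← Real.Gamma_add_two_div hs, inv_div]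

/-- First-order expansion of the logarithm of a quotient of two affine functions of the
same slope. -/
theorem abs_log_affine_div_sub_le {D κ p q t : ℝ} (hD : 0 < D) (hκ : 0 < κ) (ht : 0 < t)
    (hp : κ * t ≤ D * t + p) (hq : κ * t ≤ D * t + q) :
    |log ((D * t + p) / (D * t + q)) - (p - q) / (D * t)| ≤
      |p - q| * (|p| + |q|) / (D * κ) / t ^ 2 := by
  have hκt : 0 < κ * t := mul_pos hκ ht
  have hDt : 0 < D * t := mul_pos hD ht
  have hP : 0 < D * t + p := hκt.trans_le hp
  have hQ : 0 < D * t + q := hκt.trans_le hq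
  have upper : log ((D * t + p) / (D * t + q)) ≤ (p - q) / (D * t + q) := by
    refine (log_le_sub_one_of_pos (div_pos hP hQ)).trans_eq ?_
    field_simp
    ring
  have lower : (p - q) / (D * t + p) ≤ log ((D * t + p) / (D * t + q)) := by
    have h := log_le_sub_one_of_pos (div_pos hQ hP)
    rw [← inv_div (D * t + p), log_inv, inv_div] at h
    have h' : (D * t + q) / (D * t + p) - 1 = -((p - q) / (D * t + p)) := by
      field_simp
      ring
    linarith
  have error : ∀ r : ℝ, κ * t ≤ D * t + r → |r| ≤ |p| + |q| →
      |(p - q) / (D * t + r) - (p - q) / (D * t)| ≤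
        |p - q| * (|p| + |q|) / (D * κ) / t ^ 2 := by
    intro r hr hle
    have hR : 0 < D * t + r := hκt.trans_le hr
    have heq : (p - q) / (D * t + r) - (p - q) / (D * t) =
        -((p - q) * r / (D * t * (D * t + r))) := by
      field_simp
      ring
    rw [heq, abs_neg, abs_div, abs_mul, abs_of_pos (mul_pos hDt hR), div_div]
    have hden : D * κ * t ^ 2 ≤ D * t * (D * t + r) := by nlinarith
    gcongr
  have h1 := abs_le.mp (error p hp (le_add_of_nonneg_right (abs_nonneg q)))
  have h2 := abs_le.mp (error q hq (le_add_of_nonneg_left (abs_nonneg p)))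
  exact abs_le.mpr ⟨by linarith [h1.1], by linarith [h2.2]⟩

theorem two_le_cast {t : ℕ} (ht : 2 ≤ t) : (2 : ℝ) ≤ t := by exact_mod_cast ht

section

variable {m : ℕ} {δ : ℝ}

theorem Epsi2_eq (hδ : -(m : ℝ) < δ) {i : ℕ} (hi : 2 ≤ i) :
    Epsi2 m δ i = (m + δ) * (m + δ + 1) /
      (((2 * m + δ) * i + -(2 * m)) * ((2 * m + δ) * i + (1 - 2 * m))) := by
  have hi' := two_le_cast hi
  have hm : (0 : ℝ) ≤ m := m.cast_nonneg
  have hx : 0 < (2 * m + δ) * i - 2 * m := by nlinarith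
  rw [Epsi2, Real.Gamma_add_two_div (by linarith), Real.Gamma_div_add_two hx, ← div_eq_mul_inv]
  congr 1
  ring

theorem EOneSubPsi2_eq (hδ : -(m : ℝ) < δ) {t : ℕ} (ht : 2 ≤ t) :
    EOneSubPsi2 m δ t =
      ((2 * m + δ) * t + -(3 * m + δ)) / ((2 * m + δ) * t + -(2 * m)) *
      (((2 * m + δ) * t + (1 - (3 * m + δ))) / ((2 * m + δ) * t + (1 - 2 * m))) := by
  have ht' := two_le_cast ht
  have hm : (0 : ℝ) ≤ m := m.cast_nonneg
  have hx : 0 < (2 * m + δ) * t - 2 * m := by nlinarith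
  have hy : 0 < (2 * m + δ) * ((t : ℝ) - 1) - m := by nlinarith
  rw [EOneSubPsi2, Real.Gamma_add_two_div hy, Real.Gamma_div_add_two hx, ← div_eq_mul_inv,
    div_mul_div_comm]
  congr 1 <;> ring

theorem half_mul_le_affine (hδ : -(m : ℝ) < δ) {t : ℕ} (ht : 2 ≤ t) :
    (m + δ) / 2 * t ≤ (2 * m + δ) * t + -(3 * m + δ) := by
  have ht' := two_le_cast ht
  have hm : (0 : ℝ) ≤ m := m.cast_nonneg
  nlinarith

/-- Each factor of the product, corrected by the power `((t+1)/t)^{2β}`, is `1 + O(t⁻²)`. -/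
theorem exists_abs_log_EOneSubPsi2_le (hδ : -(m : ℝ) < δ) :
    ∃ K : ℝ, 0 ≤ K ∧ ∀ t : ℕ, 2 ≤ t → 0 < EOneSubPsi2 m δ t ∧
      |log (EOneSubPsi2 m δ t) + 2 * ((m + δ) / (2 * m + δ)) * log ((t + 1) / t)| ≤
        K / t ^ 2 := by
  have hm : (0 : ℝ) ≤ m := m.cast_nonneg
  have ha : 0 < (m : ℝ) + δ := by linarith
  have hD : 0 < 2 * (m : ℝ) + δ := by linarith
  have hκ : 0 < ((m : ℝ) + δ) / 2 := by linarith
  have hβ : 0 ≤ 2 * (((m : ℝ) + δ) / (2 * m + δ)) := by positivity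
  set D : ℝ := 2 * m + δ with hDdef
  set κ : ℝ := (m + δ) / 2 with hκdef
  set B : ℝ → ℝ → ℝ := fun p q ↦ |p - q| * (|p| + |q|) / (D * κ) with hB
  have hB0 : ∀ p q, 0 ≤ B p q := fun p q ↦ by simp only [hB]; positivity
  refine ⟨B (-(3 * m + δ)) (-(2 * m)) + B (1 - (3 * m + δ)) (1 - 2 * m) +
    2 * ((m + δ) / D) * B D 0, ?_, fun t ht ↦ ?_⟩
  · have := hB0 (-(3 * m + δ)) (-(2 * m))
    have := hB0 (1 - (3 * m + δ)) (1 - 2 * m)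
    have := mul_nonneg hβ (hB0 D 0)
    linarith
  have ht0 : (0 : ℝ) < t := by linarith [two_le_cast ht]
  have hlow : κ * t ≤ D * t + -(3 * m + δ) := half_mul_le_affine hδ ht
  have hκt : 0 < κ * t := mul_pos hκ ht0
  have h1 := abs_log_affine_div_sub_le hD hκ ht0 hlow
    (show κ * t ≤ D * t + -(2 * m) by linarith)
  have h2 := abs_log_affine_div_sub_le hD hκ ht0
    (show κ * t ≤ D * t + (1 - (3 * m + δ)) by linarith)
    (show κ * t ≤ D * t + (1 - 2 * m) by linarith)
  have h3 := abs_log_affine_div_sub_le (p := D) (q := 0) hD hκ ht0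
    (by nlinarith) (by nlinarith)
  have hpos1 : 0 < (D * t + -(3 * m + δ)) / (D * t + -(2 * m)) :=
    div_pos (by linarith) (by linarith)
  have hpos2 : 0 < (D * t + (1 - (3 * m + δ))) / (D * t + (1 - 2 * m)) :=
    div_pos (by linarith) (by linarith)
  rw [EOneSubPsi2_eq hδ ht, ← hDdef]
  refine ⟨mul_pos hpos1 hpos2, ?_⟩
  have hquot : (D * t + D) / (D * t + 0) = ((t : ℝ) + 1) / t := by
    field_simp
    ring
  rw [hquot] at h3
  have h3' := mul_le_mul_of_nonneg_left h3 hβ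
  rw [← abs_of_nonneg hβ, ← abs_mul, abs_of_nonneg hβ] at h3'
  rw [log_mul hpos1.ne' hpos2.ne']
  refine le_trans (le_of_eq ?_) ((abs_add_three _ _ _).trans
    ((add_le_add (add_le_add h1 h2) h3').trans_eq ?_))
  · congr 1
    field_simp
    ring
  · simp only [hB]
    ring

theorem exists_abs_log_Epsi2_le (hδ : -(m : ℝ) < δ) :
    ∃ K : ℝ, 0 ≤ K ∧ ∀ i : ℕ, 2 ≤ i → 0 < Epsi2 m δ i ∧
      |log (Epsi2 m δ i * (i : ℝ) ^ 2 * (2 * m + δ) ^ 2 / ((m + δ) * (m + δ + 1))) +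
        2 * ((m + δ) / (2 * m + δ)) * log ((i + 1) / i)| ≤ K / i := by
  have hm : (0 : ℝ) ≤ m := m.cast_nonneg
  have ha : 0 < (m : ℝ) + δ := by linarith
  have hD : 0 < 2 * (m : ℝ) + δ := by linarith
  have hκ : 0 < ((m : ℝ) + δ) / 2 := by linarith
  have hβ : 0 ≤ 2 * (((m : ℝ) + δ) / (2 * m + δ)) := by positivity
  set D : ℝ := 2 * m + δ with hDdef
  set κ : ℝ := (m + δ) / 2 with hκdef
  set B : ℝ → ℝ := fun q ↦ |0 - q| * (|0| + |q|) / (D * κ) + |0 - q| / D with hB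
  have hB0 : ∀ q, 0 ≤ B q := fun q ↦ by simp only [hB]; positivity
  refine ⟨B (-(2 * m)) + B (1 - 2 * m) + 2 * ((m + δ) / D), by
    linarith [hB0 (-(2 * m)), hB0 (1 - 2 * m)], fun i hi ↦ ?_⟩
  have hi2 := two_le_cast hi
  have hi0 : (0 : ℝ) < i := by linarith
  have hlow : κ * i ≤ D * i + -(3 * m + δ) := half_mul_le_affine hδ hi
  have hκt : 0 < κ * i := mul_pos hκ hi0
  have hDi : 0 < D * i := mul_pos hD hi0
  have coarse : ∀ q : ℝ, κ * i ≤ D * i + q → |log ((D * i + 0) / (D * i + q))| ≤ B q / i := by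
    intro q hq
    have h := abs_log_affine_div_sub_le (p := 0) hD hκ hi0 (by nlinarith) hq
    have h1 : |0 - q| * (|0| + |q|) / (D * κ) / (i : ℝ) ^ 2 ≤
        |0 - q| * (|0| + |q|) / (D * κ) / i :=
      div_le_div_of_nonneg_left (by positivity) hi0 (by nlinarith)
    have h2 : |(0 - q) / (D * i)| = |0 - q| / D / i := by
      rw [abs_div, abs_of_pos hDi, div_div]
    have h3 := abs_sub_abs_le_abs_sub (log ((D * i + 0) / (D * i + q))) ((0 - q) / (D * i))
    have h4 : B q / i = |0 - q| * (|0| + |q|) / (D * κ) / i + |0 - q| / D / i := add_div _ _ _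
    linarith
  have hx1 : 0 < D * i + -(2 * m) := by linarith
  have hx2 : 0 < D * i + (1 - 2 * m) := by linarith
  have h1 := coarse (-(2 * m)) (by linarith)
  have h2 := coarse (1 - 2 * m) (by linarith)
  have h3 : |2 * ((m + δ) / D) * log (((i : ℝ) + 1) / i)| ≤ 2 * ((m + δ) / D) / i := by
    have hone : (1 : ℝ) ≤ (i + 1) / i := by
      rw [le_div_iff₀ hi0]
      linarith
    have hlog := log_le_sub_one_of_pos (zero_lt_one.trans_le hone)
    rw [abs_of_nonneg (mul_nonneg hβ (log_nonneg hone)), div_eq_mul_inv _ (i : ℝ)]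
    refine mul_le_mul_of_nonneg_left (hlog.trans_eq ?_) hβ
    field_simp
    ring
  rw [Epsi2_eq hδ hi, ← hDdef]
  refine ⟨by positivity, ?_⟩
  have heq : (m + δ) * (m + δ + 1) / ((D * i + -(2 * m)) * (D * i + (1 - 2 * m))) * (i : ℝ) ^ 2 *
      D ^ 2 / ((m + δ) * (m + δ + 1)) =
      (D * i + 0) / (D * i + -(2 * m)) * ((D * i + 0) / (D * i + (1 - 2 * m))) := by
    rw [add_zero]
    field_simp
  rw [heq, log_mul (by rw [add_zero]; positivity) (by rw [add_zero]; positivity)]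
  refine (abs_add_three _ _ _).trans ((add_le_add (add_le_add h1 h2) h3).trans_eq ?_)
  ring

/-- `Q(i,j)` normalised by its leading-order asymptotics. -/
noncomputable def normalizedQedge (m : ℕ) (δ : ℝ) (i j : ℕ) : ℝ :=
  Qedge m δ i j * (i : ℝ) ^ 2 * ((j : ℝ) / (i : ℝ)) ^ (2 * (((m : ℝ) + δ) / (2 * (m : ℝ) + δ)))
    * (2 * (m : ℝ) + δ) ^ 2 / (((m : ℝ) + δ) * ((m : ℝ) + δ + 1))

theorem normalizedQedge_succ {i j : ℕ} (hi : 0 < i) (hij : i < j) :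
    normalizedQedge m δ i (j + 1) = normalizedQedge m δ i j *
      (EOneSubPsi2 m δ j * (((j : ℝ) + 1) / j) ^ (2 * (((m : ℝ) + δ) / (2 * m + δ)))) := by
  have hi' : (0 : ℝ) < i := by exact_mod_cast hi
  have hj' : (0 : ℝ) < j := by exact_mod_cast hi.trans hij
  have hquot : ((j + 1 : ℕ) : ℝ) / i = (j : ℝ) / i * ((j + 1) / j) := by
    push_cast
    field_simp
  rw [normalizedQedge, normalizedQedge, Qedge, Qedge, Finset.prod_Ico_succ_top (by omega), hquot,
    mul_rpow (by positivity) (by positivity)]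
  ring

theorem exists_abs_log_normalizedQedge_le (hδ : -(m : ℝ) < δ) :
    ∃ K : ℝ, 0 ≤ K ∧ ∀ i j : ℕ, 2 ≤ i → i < j →
      0 < normalizedQedge m δ i j ∧ |log (normalizedQedge m δ i j)| ≤ K / i := by
  obtain ⟨A, hA, hAi⟩ := exists_abs_log_Epsi2_le hδ
  obtain ⟨B, hB, hBt⟩ := exists_abs_log_EOneSubPsi2_le hδ
  have hm : (0 : ℝ) ≤ m := m.cast_nonneg
  have ha : 0 < (m : ℝ) + δ := by linarith
  have hD : 0 < 2 * (m : ℝ) + δ := by linarith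
  suffices telescoped : ∀ i j : ℕ, 2 ≤ i → i + 1 ≤ j → 0 < normalizedQedge m δ i j ∧
      |log (normalizedQedge m δ i j)| ≤ A / i + B * (1 / i - 1 / (j - 1)) by
    refine ⟨A + B, by linarith, fun i j hi hij ↦ ?_⟩
    obtain ⟨hpos, hlog⟩ := telescoped i j hi hij
    refine ⟨hpos, hlog.trans ?_⟩
    have hj : (2 : ℝ) ≤ j := two_le_cast (by omega)
    have : 0 ≤ B * (1 / ((j : ℝ) - 1)) := mul_nonneg hB (one_div_nonneg.mpr (by linarith))
    rw [add_div, div_eq_mul_one_div B]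
    linarith
  intro i j hi hij
  have hi0 : (0 : ℝ) < i := by linarith [two_le_cast hi]
  induction j, hij using Nat.le_induction with
  | base =>
    obtain ⟨hpos, hlog⟩ := hAi i hi
    have heq : normalizedQedge m δ i (i + 1) =
        Epsi2 m δ i * (i : ℝ) ^ 2 * (2 * m + δ) ^ 2 / ((m + δ) * (m + δ + 1)) *
          (((i : ℝ) + 1) / i) ^ (2 * (((m : ℝ) + δ) / (2 * m + δ))) := by
      simp only [normalizedQedge, Qedge, Finset.Ico_self, Finset.prod_empty]
      push_cast
      ring
    rw [heq]
    refine ⟨by positivity, ?_⟩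
    rw [log_mul (by positivity) (by positivity), log_rpow (by positivity)]
    push_cast
    simpa using hlog
  | succ j hij ih =>
    obtain ⟨hpos, hlog⟩ := ih
    obtain ⟨hEpos, hE⟩ := hBt j (by omega)
    have hj : (2 : ℝ) ≤ j := two_le_cast (by omega)
    rw [normalizedQedge_succ (by omega) hij]
    refine ⟨by positivity, ?_⟩
    rw [log_mul hpos.ne' (by positivity), log_mul hEpos.ne' (by positivity),
      log_rpow (by positivity)]
    refine (abs_add_le _ _).trans ((add_le_add hlog hE).trans ?_)
    have hstep : 1 / (j : ℝ) ^ 2 ≤ 1 / (j - 1) - 1 / j := by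
      have h1 : (0 : ℝ) < j - 1 := by linarith
      rw [div_sub_div _ _ h1.ne' (by positivity), div_le_div_iff₀ (by positivity) (by positivity)]
      nlinarith
    have := mul_le_mul_of_nonneg_left hstep hB
    rw [div_eq_mul_one_div B]
    push_cast
    rw [add_sub_cancel_right]
    linarith

end

theorem abs_sub_one_le_of_abs_log_le {x u : ℝ} (hx : 0 < x) (h : |log x| ≤ u) :
    |x - 1| ≤ u * exp u := by
  obtain ⟨hl, hu⟩ := abs_le.mp h
  have hu0 : 0 ≤ u := (abs_nonneg _).trans h
  have hexp : x ≤ exp u := (log_le_iff_le_exp hx).mp hu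
  have hx1 := log_le_sub_one_of_pos (inv_pos.mpr hx)
  rw [log_inv] at hx1
  have hmul : x * -log x ≤ x * (x⁻¹ - 1) := mul_le_mul_of_nonneg_left hx1 hx.le
  rw [mul_sub, mul_inv_cancel₀ hx.ne', mul_one] at hmul
  have hlow := log_le_sub_one_of_pos hx
  have h1 := add_one_le_exp u
  exact abs_le.mpr ⟨by nlinarith, by nlinarith⟩

/-- Asymptotics of `Q(i,j) = ‖θ_{ij}‖₂²`: with `β = (m+δ)/(2m+δ)`,
`Q(i,j) = ((m+δ)(m+δ+1)/(2m+δ)²) · i^{-2}·(i/j)^{2β}·(1 + O(1/i))`; in particular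
`Q(i,j) ≍ i^{2β-2} j^{-2β}`. -/
theorem Qedge_asymptotics (m : ℕ) (hm : 2 ≤ m) (δ : ℝ) (hδ : -(m : ℝ) < δ) :
    (∃ C : ℝ, 0 < C ∧ ∀ i j : ℕ, 2 ≤ i → i < j →
      |Qedge m δ i j * (i : ℝ) ^ 2 * ((j : ℝ) / (i : ℝ)) ^ (2 * (((m : ℝ) + δ) / (2 * (m : ℝ) + δ)))
          * (2 * (m : ℝ) + δ) ^ 2 / (((m : ℝ) + δ) * ((m : ℝ) + δ + 1)) - 1| ≤ C / i) ∧
    (∃ c C : ℝ, 0 < c ∧ c ≤ C ∧ ∀ i j : ℕ, 2 ≤ i → i < j →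
      c * (i : ℝ) ^ (2 * (((m : ℝ) + δ) / (2 * (m : ℝ) + δ)) - 2)
          * (j : ℝ) ^ (-(2 * (((m : ℝ) + δ) / (2 * (m : ℝ) + δ)))) ≤ Qedge m δ i j ∧
      Qedge m δ i j ≤ C * (i : ℝ) ^ (2 * (((m : ℝ) + δ) / (2 * (m : ℝ) + δ)) - 2)
          * (j : ℝ) ^ (-(2 * (((m : ℝ) + δ) / (2 * (m : ℝ) + δ))))) := by
  obtain ⟨K, hK, hR⟩ := exists_abs_log_normalizedQedge_le hδ
  have ha : 0 < (m : ℝ) + δ := by linarith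
  have hD : 0 < 2 * (m : ℝ) + δ := by linarith [(m.cast_nonneg : (0 : ℝ) ≤ m)]
  have hKi : ∀ i : ℕ, 2 ≤ i → K / i ≤ K := fun i hi ↦
    div_le_self hK (by linarith [two_le_cast hi])
  constructor
  · refine ⟨(K + 1) * exp K, by positivity, fun i j hi hij ↦ ?_⟩
    obtain ⟨hpos, hlog⟩ := hR i j hi hij
    have hi0 : (0 : ℝ) < i := by linarith [two_le_cast hi]
    refine (abs_sub_one_le_of_abs_log_le hpos hlog).trans ?_
    rw [mul_div_right_comm]
    exact mul_le_mul (by gcongr; linarith) (exp_le_exp.mpr (hKi i hi)) (exp_pos _).le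
      (by positivity)
  · have hc : 0 < ((m : ℝ) + δ) * (m + δ + 1) / (2 * m + δ) ^ 2 := by positivity
    refine ⟨exp (-K) * (((m : ℝ) + δ) * (m + δ + 1) / (2 * m + δ) ^ 2),
      exp K * (((m : ℝ) + δ) * (m + δ + 1) / (2 * m + δ) ^ 2), by positivity, by
        gcongr; linarith, fun i j hi hij ↦ ?_⟩
    obtain ⟨hpos, hlog⟩ := hR i j hi hij
    have hi0 : (0 : ℝ) < i := by linarith [two_le_cast hi]
    have hj0 : (0 : ℝ) < j := by exact_mod_cast (by omega : 0 < j)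
    obtain ⟨hl, hu⟩ := abs_le.mp (hlog.trans (hKi i hi))
    have hl' := (le_log_iff_exp_le hpos).mp hl
    have hu' := (log_le_iff_le_exp hpos).mp hu
    set b : ℝ := 2 * (((m : ℝ) + δ) / (2 * m + δ)) with hb
    have heq : Qedge m δ i j = normalizedQedge m δ i j *
        (((m : ℝ) + δ) * (m + δ + 1) / (2 * m + δ) ^ 2) * (i : ℝ) ^ (b - 2) * (j : ℝ) ^ (-b) := by
      rw [normalizedQedge, ← hb, div_rpow hj0.le hi0.le, rpow_sub hi0, rpow_neg hj0.le,
        rpow_two]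
      have := rpow_pos_of_pos hi0 b
      have := rpow_pos_of_pos hj0 b
      field_simp
    rw [heq]
    constructor <;> gcongr
end

section
/- Fix an integer m ≥ 2 and a real δ > −m. For all integers k ≥ 1 and t ≥ 3, ∏_{i=2}^{t−1} E[(1−ψ_i)^k] = ∏_{s=0}^{k−1} [ Γ(1 + (s+δ)/(2m+δ)) / Γ(1 + (s−m)/(2m+δ)) ] · [ Γ(t−1 + (s−m)/(2m+δ)) / Γ(t−1 + (s+δ)/(2m+δ)) ], where E[(1−ψ_i)^k] is given by the Gamma-ratio formula Γ((2m+δ)(i−1)−m+k)Γ((2m+δ)i−2m) / (Γ((2m+δ)(i−1)−m)Γ((2m+δ)i−2m+k)). -/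
open Real

/-- Iterated functional equation of the Gamma function. -/
theorem Gamma_add_natCast_eq_prod_mul {x : ℝ} (hx : 0 < x) (n : ℕ) :
    Real.Gamma (x + n) = (∏ j ∈ Finset.range n, (x + j)) * Real.Gamma x := by
  induction n with
  | zero => simp
  | succ n ih =>
    have hne : x + n ≠ 0 := by positivity
    rw [Finset.prod_range_succ, Nat.cast_succ, ← add_assoc, Real.Gamma_add_one hne, ih]
    ring

/-- A quotient of two shifted Gamma ratios as a product of linear quotients. -/
theorem Gamma_ratio_eq_prod_div {x y : ℝ} (hx : 0 < x) (hy : 0 < y) (n : ℕ) :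
    (Real.Gamma (x + n) * Real.Gamma y) / (Real.Gamma x * Real.Gamma (y + n)) =
      ∏ j ∈ Finset.range n, (x + j) / (y + j) := by
  have hgx := (Real.Gamma_pos_of_pos hx).ne'
  have hgy := (Real.Gamma_pos_of_pos hy).ne'
  have hprod : ∏ j ∈ Finset.range n, (y + j) ≠ 0 :=
    Finset.prod_ne_zero_iff.2 fun j _ => by positivity
  rw [Gamma_add_natCast_eq_prod_mul hx, Gamma_add_natCast_eq_prod_mul hy, Finset.prod_div_distrib]
  field_simp

/-- Product formula: for `ψ_i ~ Beta(m+δ, (2m+δ)(i-1)-m)`,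
`∏_{i=2}^{t-1} E(1-ψ_i)^k` equals an explicit product of Gamma ratios over `s = 0, …, k-1`. -/
theorem prod_one_sub_psi_pow
    (m : ℕ) (hm : 2 ≤ m) (δ : ℝ) (hδ : -(m : ℝ) < δ) (k t : ℕ) (hk : 1 ≤ k) (ht : 3 ≤ t) :
    ∏ i ∈ Finset.Icc 2 (t - 1),
      (Real.Gamma ((2 * (m : ℝ) + δ) * ((i : ℝ) - 1) - m + k) *
          Real.Gamma ((2 * (m : ℝ) + δ) * i - 2 * m)) /
        (Real.Gamma ((2 * (m : ℝ) + δ) * ((i : ℝ) - 1) - m) *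
          Real.Gamma ((2 * (m : ℝ) + δ) * i - 2 * m + k)) =
    ∏ s ∈ Finset.range k,
      (Real.Gamma (1 + ((s : ℝ) + δ) / (2 * (m : ℝ) + δ)) /
          Real.Gamma (1 + ((s : ℝ) - m) / (2 * (m : ℝ) + δ))) *
        (Real.Gamma ((t : ℝ) - 1 + ((s : ℝ) - m) / (2 * (m : ℝ) + δ)) /
          Real.Gamma ((t : ℝ) - 1 + ((s : ℝ) + δ) / (2 * (m : ℝ) + δ))) := by
  obtain ⟨n, rfl⟩ : ∃ n, t = n + 2 := ⟨t - 2, by omega⟩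
  have hm' : (2 : ℝ) ≤ m := by exact_mod_cast hm
  set c : ℝ := 2 * (m : ℝ) + δ with hc
  have hcm : (m : ℝ) < c := by linarith
  have hc0 : 0 < c := by linarith
  have hcδ : 0 < c + δ := by linarith
  have hI : Finset.Icc 2 (n + 2 - 1) = Finset.Ico 2 (n + 2) := by
    ext i
    simp only [Finset.mem_Icc, Finset.mem_Ico]
    omega
  rw [hI, Finset.prod_Ico_eq_prod_range, Nat.add_sub_cancel]
  have hleft : ∀ j : ℕ,
      (Real.Gamma (c * (((2 + j : ℕ) : ℝ) - 1) - m + k) *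
          Real.Gamma (c * ((2 + j : ℕ) : ℝ) - 2 * m)) /
        (Real.Gamma (c * (((2 + j : ℕ) : ℝ) - 1) - m) *
          Real.Gamma (c * ((2 + j : ℕ) : ℝ) - 2 * m + k)) =
      ∏ s ∈ Finset.range k, (1 + ((s : ℝ) - m) / c + j) / (1 + ((s : ℝ) + δ) / c + j) := by
    intro j
    have hj : 0 ≤ c * j := by positivity
    rw [Gamma_ratio_eq_prod_div (by push_cast; linarith) (by push_cast; linarith)]
    refine Finset.prod_congr rfl fun s _ => ?_
    have hx : c * (((2 + j : ℕ) : ℝ) - 1) - m + s = c * (1 + ((s : ℝ) - m) / c + j) := by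
      push_cast
      field_simp
      ring
    have hy : c * ((2 + j : ℕ) : ℝ) - 2 * m + s = c * (1 + ((s : ℝ) + δ) / c + j) := by
      push_cast
      field_simp
      linarith
    rw [hx, hy, mul_div_mul_left _ _ hc0.ne']
  rw [Finset.prod_congr rfl fun j _ => hleft j, Finset.prod_comm]
  refine Finset.prod_congr rfl fun s _ => ?_
  have hs : (0 : ℝ) ≤ s := s.cast_nonneg
  have ha : 0 < 1 + ((s : ℝ) - m) / c := by
    rw [one_add_div hc0.ne']
    exact div_pos (by linarith) hc0
  have hb : 0 < 1 + ((s : ℝ) + δ) / c := by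
    rw [one_add_div hc0.ne']
    exact div_pos (by linarith) hc0
  have hshift : ∀ a : ℝ, ((n + 2 : ℕ) : ℝ) - 1 + a = 1 + a + n := by
    intro a
    push_cast
    ring
  rw [← Gamma_ratio_eq_prod_div ha hb, hshift, hshift, div_mul_div_comm,
    mul_comm (Real.Gamma (1 + ((s : ℝ) + δ) / c))]
end

section
/- Let β ∈ (0,1). Then there exist constants 0 < c ≤ C, depending only on β, such that for all integers n ≥ 3: if β > 1/2 then c · log n ≤ F₃(2−2β, 1, 2β; n) ≤ C · log n; if β = 1/2 then c · (log n)³ ≤ F₃(2−2β, 1, 2β; n) ≤ C · (log n)³; and if β < 1/2 then c · n^{1−2β} · log n ≤ F₃(2−2β, 1, 2β; n) ≤ C · n^{1−2β} · log n. -/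
open Real
open scoped Classical

/-- `F_k(a₁,…,a_k; n) = ∑_{1 ≤ i₁ < ⋯ < i_k ≤ n} ∏_j i_j^{-a_j}`, encoded as a sum over
strictly monotone maps `Fin k → Fin n` (with `i_j = f j + 1 ∈ {1,…,n}`). -/
noncomputable def Fsum (k : ℕ) (a : Fin k → ℝ) (n : ℕ) : ℝ :=
  ∑ f ∈ Finset.univ.filter (fun f : Fin k → Fin n => StrictMono f),
    ∏ j : Fin k, (((f j : ℕ) : ℝ) + 1) ^ (-(a j))

/-- Splitting off the largest index of a nested power sum. -/
theorem Fsum_succ (k : ℕ) (a : Fin (k + 1) → ℝ) (n : ℕ) :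
    Fsum (k + 1) a n = ∑ m ∈ Finset.range n,
      ((m : ℝ) + 1) ^ (-(a (Fin.last k))) * Fsum k (fun j => a j.castSucc) m := by
  rw [Finset.sum_range]
  simp only [Fsum, Finset.mul_sum]
  rw [Finset.sum_sigma']
  symm
  refine Finset.sum_bij
    (fun p _ => Fin.snoc (α := fun _ => Fin n) (fun i => Fin.castLE p.1.2.le (p.2 i)) p.1)
    ?_ ?_ ?_ ?_
  · rintro ⟨m, g⟩ h
    simp only [Finset.mem_sigma, Finset.mem_univ, Finset.mem_filter, true_and] at h ⊢
    intro i j hij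
    induction j using Fin.lastCases with
    | last =>
      induction i using Fin.lastCases with
      | last => exact absurd hij (lt_irrefl _)
      | cast i =>
        simp only [Fin.snoc_castSucc, Fin.snoc_last]
        exact (g i).2
    | cast j =>
      induction i using Fin.lastCases with
      | last => exact absurd (hij.trans (Fin.castSucc_lt_last j)) (lt_irrefl _)
      | cast i =>
        simp only [Fin.snoc_castSucc]
        exact h (Fin.castSucc_lt_castSucc_iff.mp hij)
  · rintro ⟨m, g⟩ _ ⟨m', g'⟩ _ h
    have hm : m = m' := by simpa using congrFun h (Fin.last k)
    subst hm
    have hg : g = g' := by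
      funext i
      simpa [Fin.ext_iff] using congrFun h i.castSucc
    rw [hg]
  · intro f hf
    simp only [Finset.mem_univ, Finset.mem_filter, true_and] at hf
    refine ⟨⟨f (Fin.last k), fun i => ⟨f i.castSucc, hf (Fin.castSucc_lt_last i)⟩⟩, ?_, ?_⟩
    · simp only [Finset.mem_sigma, Finset.mem_univ, Finset.mem_filter, true_and]
      intro i j hij
      exact hf (Fin.castSucc_lt_castSucc_iff.mpr hij)
    · funext i
      induction i using Fin.lastCases with
      | last => simp
      | cast i => simp
  · rintro ⟨m, g⟩ _
    simp [Fin.prod_univ_castSucc, mul_comm]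

theorem Fsum_zero (a : Fin 0 → ℝ) (n : ℕ) : Fsum 0 a n = 1 := by
  simp [Fsum, Subsingleton.strictMono]

/-- The power sum `∑_{1 ≤ i ≤ n} i^{-a}`. -/
noncomputable def powerSum (a : ℝ) (n : ℕ) : ℝ :=
  ∑ i ∈ Finset.range n, ((i : ℝ) + 1) ^ (-a)

/-- The double sum `∑_{1 ≤ i < j ≤ n} i^{-a} j^{-b}`. -/
noncomputable def powerSumTwo (a b : ℝ) (n : ℕ) : ℝ :=
  ∑ j ∈ Finset.range n, ((j : ℝ) + 1) ^ (-b) * powerSum a j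

/-- The triple sum `∑_{1 ≤ i < j < k ≤ n} i^{-a} j^{-b} k^{-c}`. -/
noncomputable def powerSumThree (a b c : ℝ) (n : ℕ) : ℝ :=
  ∑ k ∈ Finset.range n, ((k : ℝ) + 1) ^ (-c) * powerSumTwo a b k

theorem Fsum_three (a b c : ℝ) (n : ℕ) : Fsum 3 ![a, b, c] n = powerSumThree a b c n := by
  simp only [Fsum_succ, Fsum_zero, powerSumThree, powerSumTwo, powerSum, mul_one]
  rfl

theorem powerSum_succ (a : ℝ) (n : ℕ) :
    powerSum a (n + 1) = powerSum a n + ((n : ℝ) + 1) ^ (-a) :=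
  Finset.sum_range_succ _ _

theorem powerSumTwo_succ (a b : ℝ) (n : ℕ) :
    powerSumTwo a b (n + 1) = powerSumTwo a b n + ((n : ℝ) + 1) ^ (-b) * powerSum a n :=
  Finset.sum_range_succ _ _

theorem powerSumThree_succ (a b c : ℝ) (n : ℕ) :
    powerSumThree a b c (n + 1) =
      powerSumThree a b c n + ((n : ℝ) + 1) ^ (-c) * powerSumTwo a b n :=
  Finset.sum_range_succ _ _

theorem powerSum_nonneg (a : ℝ) (n : ℕ) : 0 ≤ powerSum a n :=
  Finset.sum_nonneg fun _ _ => by positivity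

theorem powerSum_mono (a : ℝ) : Monotone (powerSum a) :=
  monotone_nat_of_le_succ fun n => by
    rw [powerSum_succ]; exact le_add_of_nonneg_right (by positivity)

theorem powerSumTwo_le (a b : ℝ) (n : ℕ) : powerSumTwo a b n ≤ powerSum b n * powerSum a n := by
  rw [powerSumTwo, powerSum, Finset.sum_mul]
  refine Finset.sum_le_sum fun j hj => ?_
  gcongr
  exact powerSum_mono a (Finset.mem_range.mp hj).le

theorem powerSumThree_le (a b c : ℝ) (n : ℕ) :
    powerSumThree a b c n ≤ powerSum c n * (powerSum b n * powerSum a n) := by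
  rw [powerSumThree, powerSum, Finset.sum_mul]
  refine Finset.sum_le_sum fun k hk => ?_
  have hk := (Finset.mem_range.mp hk).le
  gcongr
  exact (powerSumTwo_le a b k).trans
    (mul_le_mul (powerSum_mono b hk) (powerSum_mono a hk) (powerSum_nonneg _ _)
      (powerSum_nonneg _ _))

theorem powerSumThree_three (a b c : ℝ) :
    powerSumThree a b c 3 = (3 : ℝ) ^ (-c) * (2 : ℝ) ^ (-b) := by
  simp [powerSumThree, powerSumTwo, powerSum, Finset.sum_range_succ]
  norm_num

theorem powerSumTwo_two (a b : ℝ) : powerSumTwo a b 2 = (2 : ℝ) ^ (-b) := by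
  simp [powerSumTwo, powerSum, Finset.sum_range_succ]
  norm_num

theorem inv_le_two_div_succ {n : ℕ} (hn : 1 ≤ n) : (n : ℝ)⁻¹ ≤ 2 / ((n : ℝ) + 1) := by
  have : (1 : ℝ) ≤ n := by exact_mod_cast hn
  rw [inv_eq_one_div, div_le_div_iff₀ (by positivity) (by positivity)]
  linarith

theorem log_succ_sub_log_le {n : ℕ} (hn : 1 ≤ n) :
    Real.log ((n : ℝ) + 1) - Real.log n ≤ 2 / ((n : ℝ) + 1) := by
  have h : (0 : ℝ) < n := by exact_mod_cast hn
  rw [← Real.log_div (by positivity) h.ne']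
  refine (Real.log_le_sub_one_of_pos (by positivity)).trans
    (le_trans (le_of_eq ?_) (inv_le_two_div_succ hn))
  field_simp
  ring

theorem log_three_le_two : Real.log 3 ≤ 2 :=
  (Real.log_le_sub_one_of_pos (by norm_num)).trans (by norm_num)

theorem one_le_log_natCast {n : ℕ} (hn : 3 ≤ n) : 1 ≤ Real.log n := by
  have h : (3 : ℝ) ≤ n := by exact_mod_cast hn
  rw [Real.le_log_iff_exp_le (by linarith)]
  linarith [Real.exp_one_lt_d9]

theorem powerSum_one_eq_harmonic (n : ℕ) : powerSum 1 n = harmonic n := by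
  simp [powerSum, harmonic, Real.rpow_neg_one]

theorem powerSum_one_le_two_mul_log {n : ℕ} (hn : 3 ≤ n) : powerSum 1 n ≤ 2 * Real.log n := by
  rw [powerSum_one_eq_harmonic]
  linarith [harmonic_le_one_add_log n, one_le_log_natCast hn]

theorem log_le_powerSum_one (n : ℕ) : Real.log ((n : ℝ) + 1) ≤ powerSum 1 n := by
  rw [powerSum_one_eq_harmonic]
  exact_mod_cast log_add_one_le_harmonic n

theorem rpow_succ_sub_rpow_le {s : ℝ} (hs : s ≤ 1) (n : ℕ) :
    ((n : ℝ) + 1) ^ s - (n : ℝ) ^ s ≤ ((n : ℝ) + 1) ^ (s - 1) := by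
  have h1 : (0 : ℝ) < n + 1 := by positivity
  have hx : (n : ℝ) / (n + 1) ≤ ((n : ℝ) / (n + 1)) ^ s := by
    rcases Nat.eq_zero_or_pos n with rfl | hn
    · simp [Real.rpow_nonneg]
    · have h0 : (0 : ℝ) < n := by exact_mod_cast hn
      refine Real.self_le_rpow_of_le_one (by positivity) ?_ hs
      rw [div_le_one h1]; linarith
  rw [Real.div_rpow (by positivity) h1.le, div_le_div_iff₀ h1 (by positivity)] at hx
  rw [Real.rpow_sub_one h1.ne', le_div_iff₀ h1]
  linarith

theorem mul_rpow_sub_one_le_rpow_succ_sub {s : ℝ} (hs0 : 0 < s) (hs : s ≤ 1) (n : ℕ) :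
    s * ((n : ℝ) + 1) ^ (s - 1) ≤ ((n : ℝ) + 1) ^ s - (n : ℝ) ^ s := by
  have h1 : (0 : ℝ) < n + 1 := by positivity
  have hy : ((n : ℝ) + 1)⁻¹ ≤ 1 := inv_le_one_of_one_le₀ (by linarith [Nat.cast_nonneg (α := ℝ) n])
  have h := rpow_one_add_le_one_add_mul_self (s := -((n : ℝ) + 1)⁻¹) (by linarith) hs0.le hs
  have he : 1 + -((n : ℝ) + 1)⁻¹ = (n : ℝ) / (n + 1) := by field_simp; ring
  rw [he, Real.div_rpow (by positivity) h1.le, div_le_iff₀ (by positivity)] at h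
  rw [Real.rpow_sub_one h1.ne']
  have : (1 + s * -((n : ℝ) + 1)⁻¹) * ((n : ℝ) + 1) ^ s =
      ((n : ℝ) + 1) ^ s - s * (((n : ℝ) + 1) ^ s / (n + 1)) := by ring
  linarith

theorem powerSum_le_rpow_div {s : ℝ} (hs0 : 0 < s) (hs : s ≤ 1) (n : ℕ) :
    powerSum (1 - s) n ≤ (n : ℝ) ^ s / s := by
  induction n with
  | zero => simp [powerSum, Real.zero_rpow hs0.ne']
  | succ n ih =>
    have h := mul_rpow_sub_one_le_rpow_succ_sub hs0 hs n
    rw [powerSum_succ, neg_sub, Nat.cast_succ]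
    rw [le_div_iff₀ hs0] at ih ⊢
    linarith

theorem powerSum_le_tsum {a : ℝ} (ha : 1 < a) (n : ℕ) :
    powerSum a n ≤ ∑' i : ℕ, ((i : ℝ) + 1) ^ (-a) := by
  refine Summable.sum_le_tsum _ (fun _ _ => by positivity) ?_
  have := (summable_nat_add_iff 1).mpr (Real.summable_nat_rpow.mpr (neg_lt_neg ha))
  exact_mod_cast this

theorem rpow_le_powerSum {s : ℝ} (hs : s ≤ 1) (n : ℕ) (hn : 1 ≤ n) :
    (n : ℝ) ^ s ≤ powerSum (1 - s) n := by
  induction n, hn using Nat.le_induction with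
  | base => simp [powerSum]
  | succ n hn ih =>
    have h := rpow_succ_sub_rpow_le hs n
    rw [powerSum_succ, neg_sub, Nat.cast_succ]
    linarith

theorem succ_rpow_le_two_mul_rpow {s : ℝ} (hs0 : 0 ≤ s) (hs : s ≤ 1) {n : ℕ} (hn : 1 ≤ n) :
    ((n : ℝ) + 1) ^ s ≤ 2 * (n : ℝ) ^ s := by
  have h1 : (1 : ℝ) ≤ n := by exact_mod_cast hn
  have h2 : (2 : ℝ) ^ s ≤ 2 := by
    simpa using Real.rpow_le_rpow_of_exponent_le (one_le_two (α := ℝ)) hs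
  calc ((n : ℝ) + 1) ^ s ≤ (2 * (n : ℝ)) ^ s := by gcongr; linarith
    _ = 2 ^ s * (n : ℝ) ^ s := Real.mul_rpow (by norm_num) (by positivity)
    _ ≤ 2 * (n : ℝ) ^ s := by gcongr

theorem log_le_powerSumThree {s : ℝ} (hs0 : 0 < s) (hs : s ≤ 1) (n : ℕ) (hn : 3 ≤ n) :
    1 / 36 * Real.log n ≤ powerSumThree (1 - s) 1 (1 + s) n := by
  have htwo : ∀ m : ℕ, 2 ≤ m → 1 / 4 * (m : ℝ) ^ s ≤ powerSumTwo (1 - s) 1 m := by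
    intro m hm
    induction m, hm using Nat.le_induction with
    | base =>
      have h : (2 : ℝ) ^ s ≤ 2 := by
        simpa using Real.rpow_le_rpow_of_exponent_le (one_le_two (α := ℝ)) hs
      rw [powerSumTwo_two, Real.rpow_neg_one]
      push_cast
      linarith
    | succ m hm ih =>
      have hpos : (0 : ℝ) < (m : ℝ) + 1 := by positivity
      have hinc := rpow_succ_sub_rpow_le hs m
      have hone := rpow_le_powerSum hs m (by omega)
      have hle := succ_rpow_le_two_mul_rpow hs0.le hs (n := m) (by omega)
      have hkey : 1 / 4 * ((m : ℝ) + 1) ^ (s - 1) ≤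
          ((m : ℝ) + 1) ^ (-1 : ℝ) * powerSum (1 - s) m := by
        rw [Real.rpow_sub_one hpos.ne', Real.rpow_neg_one, div_eq_inv_mul (((m : ℝ) + 1) ^ s),
          mul_left_comm]
        gcongr
        linarith [Real.rpow_nonneg hpos.le s]
      rw [powerSumTwo_succ, Nat.cast_succ]
      linarith
  induction n, hn using Nat.le_induction with
  | base =>
    rw [powerSumThree_three]
    have h : (3 : ℝ) ^ (-2 : ℝ) ≤ (3 : ℝ) ^ (-(1 + s)) :=
      Real.rpow_le_rpow_of_exponent_le (by norm_num) (by linarith)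
    have h9 : (3 : ℝ) ^ (-2 : ℝ) = 1 / 9 := by
      rw [Real.rpow_neg (by norm_num)]; norm_num
    rw [h9] at h
    rw [Real.rpow_neg_one]
    push_cast
    linarith [log_three_le_two]
  | succ n hn ih =>
    have hpos : (0 : ℝ) < (n : ℝ) + 1 := by positivity
    have hlog := log_succ_sub_log_le (n := n) (by omega)
    have hle := succ_rpow_le_two_mul_rpow hs0.le hs (n := n) (by omega)
    have hkey : 1 / 8 * (1 / ((n : ℝ) + 1)) ≤
        ((n : ℝ) + 1) ^ (-(1 + s)) * powerSumTwo (1 - s) 1 n := by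
      calc 1 / 8 * (1 / ((n : ℝ) + 1))
          = ((n : ℝ) + 1) ^ (-(1 + s)) * (1 / 8 * ((n : ℝ) + 1) ^ s) := by
            rw [mul_left_comm, ← Real.rpow_add hpos, neg_add, neg_add_cancel_right,
              Real.rpow_neg_one, one_div ((n : ℝ) + 1)]
        _ ≤ _ := by
            gcongr
            linarith [htwo n (by omega)]
    have h0 : 0 < 1 / ((n : ℝ) + 1) := by positivity
    have h2 : 2 / ((n : ℝ) + 1) = 2 * (1 / ((n : ℝ) + 1)) := by ring
    rw [powerSumThree_succ, Nat.cast_succ]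
    linarith

theorem powerSumThree_le_log {s : ℝ} (hs0 : 0 < s) (hs : s ≤ 1) (n : ℕ) (hn : 3 ≤ n) :
    powerSumThree (1 - s) 1 (1 + s) n ≤ 2 / s ^ 2 * Real.log n := by
  have htwo : ∀ m : ℕ, powerSumTwo (1 - s) 1 m ≤ (m : ℝ) ^ s / s ^ 2 := by
    intro m
    calc powerSumTwo (1 - s) 1 m ≤ powerSum (1 - s) m / s := by
          rw [powerSumTwo, powerSum, Finset.sum_div]
          refine Finset.sum_le_sum fun j _ => ?_
          have hpos : (0 : ℝ) < (j : ℝ) + 1 := by positivity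
          calc ((j : ℝ) + 1) ^ (-1 : ℝ) * powerSum (1 - s) j
              ≤ ((j : ℝ) + 1) ^ (-1 : ℝ) * (((j : ℝ) + 1) ^ s / s) := by
                gcongr
                refine (powerSum_le_rpow_div hs0 hs j).trans ?_
                gcongr
                linarith
            _ = ((j : ℝ) + 1) ^ (-(1 - s)) / s := by
                rw [mul_div_assoc', ← Real.rpow_add hpos]
                congr 2
                ring
      _ ≤ (m : ℝ) ^ s / s / s := by
          gcongr
          exact powerSum_le_rpow_div hs0 hs m
      _ = (m : ℝ) ^ s / s ^ 2 := by rw [div_div, sq]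
  calc powerSumThree (1 - s) 1 (1 + s) n ≤ powerSum 1 n / s ^ 2 := by
        rw [powerSumThree, powerSum, Finset.sum_div]
        refine Finset.sum_le_sum fun k _ => ?_
        have hpos : (0 : ℝ) < (k : ℝ) + 1 := by positivity
        calc ((k : ℝ) + 1) ^ (-(1 + s)) * powerSumTwo (1 - s) 1 k
            ≤ ((k : ℝ) + 1) ^ (-(1 + s)) * (((k : ℝ) + 1) ^ s / s ^ 2) := by
              gcongr
              refine (htwo k).trans ?_
              gcongr
              linarith
          _ = ((k : ℝ) + 1) ^ (-1 : ℝ) / s ^ 2 := by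
              rw [mul_div_assoc', ← Real.rpow_add hpos]
              congr 2
              ring
    _ ≤ 2 * Real.log n / s ^ 2 := by
        gcongr
        exact powerSum_one_le_two_mul_log hn
    _ = 2 / s ^ 2 * Real.log n := by ring

theorem log_sq_le_powerSumTwo (n : ℕ) (hn : 1 ≤ n) :
    1 / 4 * Real.log n ^ 2 ≤ powerSumTwo 1 1 n := by
  induction n, hn using Nat.le_induction with
  | base => simp [powerSumTwo, powerSum]
  | succ n hn ih =>
    have hn' : (1 : ℝ) ≤ n := by exact_mod_cast hn
    have hinc := log_succ_sub_log_le hn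
    have hmono : Real.log n ≤ Real.log ((n : ℝ) + 1) :=
      Real.log_le_log (by linarith) (by linarith)
    have h0 : 0 ≤ Real.log n := Real.log_nonneg hn'
    have hkey : ((n : ℝ) + 1)⁻¹ * Real.log ((n : ℝ) + 1) ≤
        ((n : ℝ) + 1)⁻¹ * powerSum 1 n := by
      gcongr
      exact log_le_powerSum_one n
    rw [div_eq_mul_inv] at hinc
    rw [powerSumTwo_succ, Nat.cast_succ, Real.rpow_neg_one]
    nlinarith [mul_le_mul hinc
      (by linarith : Real.log ((n : ℝ) + 1) + Real.log n ≤ 2 * Real.log ((n : ℝ) + 1))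
      (by linarith) (by positivity)]

theorem log_cube_le_powerSumThree (n : ℕ) (hn : 3 ≤ n) :
    1 / 96 * Real.log n ^ 3 ≤ powerSumThree 1 1 1 n := by
  induction n, hn using Nat.le_induction with
  | base =>
    have h : Real.log 3 ^ 3 ≤ 2 ^ 3 :=
      pow_le_pow_left₀ (Real.log_nonneg (by norm_num)) log_three_le_two 3
    rw [powerSumThree_three]
    norm_num [Real.rpow_neg_one] at h ⊢
    linarith
  | succ n hn ih =>
    have hn' : (3 : ℝ) ≤ n := by exact_mod_cast hn
    have hinc := log_succ_sub_log_le (n := n) (by omega)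
    have hone := one_le_log_natCast hn
    have hmono : Real.log n ≤ Real.log ((n : ℝ) + 1) :=
      Real.log_le_log (by linarith) (by linarith)
    have hle : 2 / ((n : ℝ) + 1) ≤ 1 := by
      rw [div_le_one (by linarith)]; linarith
    have hdouble : Real.log ((n : ℝ) + 1) ≤ 2 * Real.log n := by linarith
    have hkey : ((n : ℝ) + 1)⁻¹ * (1 / 4 * Real.log n ^ 2) ≤
        ((n : ℝ) + 1)⁻¹ * powerSumTwo 1 1 n := by
      gcongr
      exact log_sq_le_powerSumTwo n (by omega)
    rw [div_eq_mul_inv] at hinc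
    rw [powerSumThree_succ, Nat.cast_succ, Real.rpow_neg_one]
    have hsq : Real.log ((n : ℝ) + 1) ^ 2 + Real.log ((n : ℝ) + 1) * Real.log n +
        Real.log n ^ 2 ≤ 12 * Real.log n ^ 2 := by nlinarith
    nlinarith [mul_le_mul hinc hsq (by nlinarith) (by positivity)]

theorem powerSumThree_le_log_cube (n : ℕ) (hn : 3 ≤ n) :
    powerSumThree 1 1 1 n ≤ 8 * Real.log n ^ 3 := by
  have h := powerSum_one_le_two_mul_log hn
  have h0 := powerSum_nonneg 1 n
  calc powerSumThree 1 1 1 n ≤ powerSum 1 n * (powerSum 1 n * powerSum 1 n) :=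
        powerSumThree_le 1 1 1 n
    _ = powerSum 1 n ^ 3 := by ring
    _ ≤ (2 * Real.log n) ^ 3 := by gcongr
    _ = 8 * Real.log n ^ 3 := by ring

theorem log_le_powerSumTwo {a : ℝ} (n : ℕ) (hn : 2 ≤ n) :
    1 / 4 * Real.log n ≤ powerSumTwo a 1 n := by
  induction n, hn using Nat.le_induction with
  | base =>
    rw [powerSumTwo_two, Real.rpow_neg_one]
    push_cast
    linarith [Real.log_two_lt_d9]
  | succ n hn ih =>
    have hinc := log_succ_sub_log_le (n := n) (by omega)
    have hone : 1 ≤ powerSum a n := by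
      simpa [powerSum] using powerSum_mono a (by omega : 1 ≤ n)
    have hkey : ((n : ℝ) + 1)⁻¹ * 1 ≤ ((n : ℝ) + 1)⁻¹ * powerSum a n := by gcongr
    have h0 : 0 < ((n : ℝ) + 1)⁻¹ := by positivity
    rw [div_eq_mul_inv] at hinc
    rw [powerSumTwo_succ, Nat.cast_succ, Real.rpow_neg_one]
    linarith

theorem rpow_mul_log_le_powerSumThree {a s : ℝ} (hs : s ≤ 1) (n : ℕ) (hn : 3 ≤ n) :
    1 / 12 * (n : ℝ) ^ s * Real.log n ≤ powerSumThree a 1 (1 - s) n := by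
  induction n, hn using Nat.le_induction with
  | base =>
    have h3 : (3 : ℝ) ^ (-(1 - s)) = 3 ^ s / 3 := by
      rw [neg_sub, Real.rpow_sub_one (by norm_num)]
    rw [powerSumThree_three, h3, Real.rpow_neg_one]
    push_cast
    nlinarith [log_three_le_two, Real.rpow_nonneg (by norm_num : (0 : ℝ) ≤ 3) s]
  | succ n hn ih =>
    have hpos : (0 : ℝ) < (n : ℝ) + 1 := by positivity
    have hlog := log_succ_sub_log_le (n := n) (by omega)
    have hone := one_le_log_natCast hn
    have hpow := rpow_succ_sub_rpow_le hs n
    have hp : ((n : ℝ) + 1) ^ s = ((n : ℝ) + 1) ^ (s - 1) * (n + 1) := by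
      rw [Real.rpow_sub_one hpos.ne']; field_simp
    have hkey : ((n : ℝ) + 1) ^ (s - 1) * (1 / 4 * Real.log n) ≤
        ((n : ℝ) + 1) ^ (s - 1) * powerSumTwo a 1 n := by
      gcongr
      exact log_le_powerSumTwo n (by omega)
    have hfirst : ((n : ℝ) + 1) ^ s * (Real.log ((n : ℝ) + 1) - Real.log n) ≤
        2 * ((n : ℝ) + 1) ^ (s - 1) * Real.log n := by
      calc _ ≤ ((n : ℝ) + 1) ^ s * (2 / ((n : ℝ) + 1)) := by gcongr
        _ = 2 * ((n : ℝ) + 1) ^ (s - 1) * 1 := by rw [hp]; field_simp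
        _ ≤ _ := by gcongr
    have hsecond := mul_le_mul_of_nonneg_right hpow (by linarith : 0 ≤ Real.log n)
    rw [powerSumThree_succ, Nat.cast_succ, neg_sub]
    linarith

theorem powerSumThree_le_rpow_mul_log {a s : ℝ} (ha : 1 < a) (hs0 : 0 < s) (hs : s ≤ 1)
    (n : ℕ) (hn : 3 ≤ n) :
    powerSumThree a 1 (1 - s) n ≤
      2 * (∑' i : ℕ, ((i : ℝ) + 1) ^ (-a)) / s * (n : ℝ) ^ s * Real.log n := by
  have hone := one_le_log_natCast hn
  calc powerSumThree a 1 (1 - s) n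
      ≤ powerSum (1 - s) n * (powerSum 1 n * powerSum a n) := powerSumThree_le a 1 (1 - s) n
    _ ≤ (n : ℝ) ^ s / s * (2 * Real.log n * ∑' i : ℕ, ((i : ℝ) + 1) ^ (-a)) := by
        gcongr
        · exact mul_nonneg (powerSum_nonneg _ _) (powerSum_nonneg _ _)
        · exact powerSum_le_rpow_div hs0 hs n
        · exact powerSum_nonneg _ _
        · exact powerSum_one_le_two_mul_log hn
        · exact powerSum_le_tsum ha n
    _ = _ := by ring

/-- Order of `F₃(2-2β, 1, 2β; n)`, the expected number of triangles in `PAM_n(m,δ)`: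
`log n` for `β > 1/2`, `(log n)³` for `β = 1/2`, and `n^{1-2β} log n` for `β < 1/2`. -/
theorem F3_triangle_asymptotics (β : ℝ) (hβ : β ∈ Set.Ioo (0 : ℝ) 1) :
    ∃ c C : ℝ, 0 < c ∧ c ≤ C ∧ ∀ n : ℕ, 3 ≤ n →
      (1 / 2 < β →
        c * Real.log n ≤ Fsum 3 ![2 - 2 * β, 1, 2 * β] n ∧
        Fsum 3 ![2 - 2 * β, 1, 2 * β] n ≤ C * Real.log n) ∧
      (β = 1 / 2 →
        c * (Real.log n) ^ 3 ≤ Fsum 3 ![2 - 2 * β, 1, 2 * β] n ∧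
        Fsum 3 ![2 - 2 * β, 1, 2 * β] n ≤ C * (Real.log n) ^ 3) ∧
      (β < 1 / 2 →
        c * (n : ℝ) ^ (1 - 2 * β) * Real.log n ≤ Fsum 3 ![2 - 2 * β, 1, 2 * β] n ∧
        Fsum 3 ![2 - 2 * β, 1, 2 * β] n ≤ C * (n : ℝ) ^ (1 - 2 * β) * Real.log n) := by
  obtain ⟨h0, h1⟩ := hβ
  simp only [Fsum_three]
  rcases lt_trichotomy β (1 / 2) with h | h | h
  · have key : ∀ n : ℕ, 3 ≤ n →
        1 / 12 * (n : ℝ) ^ (1 - 2 * β) * Real.log n ≤ powerSumThree (2 - 2 * β) 1 (2 * β) n ∧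
        powerSumThree (2 - 2 * β) 1 (2 * β) n ≤
          2 * (∑' i : ℕ, ((i : ℝ) + 1) ^ (-(2 - 2 * β))) / (1 - 2 * β) *
            (n : ℝ) ^ (1 - 2 * β) * Real.log n := by
      intro n hn
      have hlow := rpow_mul_log_le_powerSumThree (a := 2 - 2 * β) (s := 1 - 2 * β)
        (by linarith) n hn
      have hup := powerSumThree_le_rpow_mul_log (a := 2 - 2 * β) (s := 1 - 2 * β)
        (by linarith) (by linarith) (by linarith) n hn
      rw [sub_sub_cancel] at hlow hup
      exact ⟨hlow, hup⟩
    refine ⟨1 / 12, _, by norm_num, ?_, fun n hn =>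
      ⟨fun h' => absurd h' (by linarith), fun h' => absurd h' (by linarith), fun _ => key n hn⟩⟩
    have hk := (key 3 le_rfl).1.trans (key 3 le_rfl).2
    rw [mul_assoc, mul_assoc _ (((3 : ℕ) : ℝ) ^ (1 - 2 * β))] at hk
    have hlog := one_le_log_natCast (le_refl 3)
    exact le_of_mul_le_mul_right hk (mul_pos (by positivity) (by linarith))
  · subst h
    refine ⟨1 / 96, 8, by norm_num, by norm_num, fun n hn =>
      ⟨fun h' => absurd h' (by linarith), fun _ => ?_, fun h' => absurd h' (by linarith)⟩⟩
    norm_num only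
    have hlow := log_cube_le_powerSumThree n hn
    have hup := powerSumThree_le_log_cube n hn
    exact ⟨by linarith, hup⟩
  · have key : ∀ n : ℕ, 3 ≤ n →
        1 / 36 * Real.log n ≤ powerSumThree (2 - 2 * β) 1 (2 * β) n ∧
        powerSumThree (2 - 2 * β) 1 (2 * β) n ≤ 2 / (2 * β - 1) ^ 2 * Real.log n := by
      intro n hn
      have hlow := log_le_powerSumThree (s := 2 * β - 1) (by linarith) (by linarith) n hn
      have hup := powerSumThree_le_log (s := 2 * β - 1) (by linarith) (by linarith) n hn
      rw [show 1 - (2 * β - 1) = 2 - 2 * β by ring, add_sub_cancel] at hlow hup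
      exact ⟨hlow, hup⟩
    refine ⟨1 / 36, _, by norm_num, ?_, fun n hn =>
      ⟨fun _ => key n hn, fun h' => absurd h' (by linarith), fun h' => absurd h' (by linarith)⟩⟩
    have hlog := one_le_log_natCast (le_refl 3)
    exact le_of_mul_le_mul_right ((key 3 le_rfl).1.trans (key 3 le_rfl).2) (by linarith)
end

section
/- Let ℓ ≥ 4 be an integer and β ∈ (0, 1/2], and for i ∈ {1, …, ℓ} set x_i := (1−2β)(ℓ−i) + β(ℓ−1). Then there exist constants 0 < c ≤ C, depending only on ℓ and β, such that for all integers n ≥ 2ℓ: if β > 1/(ℓ−1) then c ≤ F_ℓ(x₁,…,x_ℓ; n) ≤ C; if β = 1/(ℓ−1) then c · log n ≤ F_ℓ(x₁,…,x_ℓ; n) ≤ C · log n; and if β < 1/(ℓ−1) then c · n^{1−β(ℓ−1)} ≤ F_ℓ(x₁,…,x_ℓ; n) ≤ C · n^{1−β(ℓ−1)}. -/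
open Real
open scoped Classical

/-- The truncated zeta sum `∑_{i=1}^n i^{-b}`. -/
noncomputable def zetaSum (b : ℝ) (n : ℕ) : ℝ :=
  ∑ m ∈ Finset.range n, ((m : ℝ) + 1) ^ (-b)

lemma zetaSum_nonneg (b : ℝ) (n : ℕ) : 0 ≤ zetaSum b n :=
  Finset.sum_nonneg fun _ _ => by positivity

lemma one_le_zetaSum (b : ℝ) {n : ℕ} (hn : 0 < n) : 1 ≤ zetaSum b n := by
  have := Finset.single_le_sum (f := fun m : ℕ => ((m : ℝ) + 1) ^ (-b)) (s := Finset.range n)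
    (fun _ _ => by positivity) (Finset.mem_range.2 hn)
  simpa [zetaSum] using this

lemma exists_zetaSum_le {b : ℝ} (hb : 1 < b) : ∃ C : ℝ, ∀ n, zetaSum b n ≤ C := by
  have hs : Summable fun m : ℕ => ((m : ℝ) + 1) ^ (-b) := by
    have := (summable_nat_add_iff 1).2 (Real.summable_nat_rpow.2 (show -b < -1 by linarith))
    simpa using this
  exact ⟨_, fun n => hs.sum_le_tsum _ fun _ _ => by positivity⟩

lemma zetaSum_one (n : ℕ) : zetaSum 1 n = (harmonic n : ℝ) := by
  simp [zetaSum, harmonic, Real.rpow_neg_one]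

lemma rpow_one_sub_le_zetaSum {b : ℝ} (hb : 0 ≤ b) {n : ℕ} (hn : 0 < n) :
    (n : ℝ) ^ (1 - b) ≤ zetaSum b n := by
  have hn' : (0 : ℝ) < n := by exact_mod_cast hn
  have h : ∑ _m ∈ Finset.range n, (n : ℝ) ^ (-b) ≤ zetaSum b n := by
    refine Finset.sum_le_sum fun m hm => ?_
    refine Real.rpow_le_rpow_of_nonpos (by positivity) ?_ (by linarith)
    exact_mod_cast Finset.mem_range.1 hm
  rw [Finset.sum_const, Finset.card_range, nsmul_eq_mul] at h
  rwa [sub_eq_add_neg, Real.rpow_add hn', Real.rpow_one]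

lemma zetaSum_le_rpow_one_sub {b : ℝ} (hb0 : 0 ≤ b) (hb : b < 1) (n : ℕ) :
    (1 - b) * zetaSum b n ≤ (n : ℝ) ^ (1 - b) := by
  induction n with
  | zero => simp [zetaSum, Real.zero_rpow (show 1 - b ≠ 0 by linarith)]
  | succ n ih =>
    have hpos : (0 : ℝ) < (n : ℝ) + 1 := by positivity
    have hle : -1 ≤ -(1 / ((n : ℝ) + 1)) := by
      rw [neg_le_neg_iff, div_le_one hpos]
      linarith [Nat.cast_nonneg (α := ℝ) n]
    have hbern := rpow_one_add_le_one_add_mul_self hle (show 0 ≤ 1 - b by linarith)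
      (show 1 - b ≤ 1 by linarith)
    have hmul := mul_le_mul_of_nonneg_left hbern (Real.rpow_nonneg hpos.le (1 - b))
    have hl : ((n : ℝ) + 1) ^ (1 - b) * (1 + -(1 / ((n : ℝ) + 1))) ^ (1 - b) =
        (n : ℝ) ^ (1 - b) := by
      rw [← Real.mul_rpow hpos.le (by linarith)]
      congr 1
      field_simp
      ring
    have hr : ((n : ℝ) + 1) ^ (1 - b) = ((n : ℝ) + 1) * ((n : ℝ) + 1) ^ (-b) := by
      rw [sub_eq_add_neg, Real.rpow_add hpos, Real.rpow_one]
    have hr' : ((n : ℝ) + 1) ^ (1 - b) * (1 + (1 - b) * -(1 / ((n : ℝ) + 1))) =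
        ((n : ℝ) + 1) ^ (1 - b) - (1 - b) * ((n : ℝ) + 1) ^ (-b) := by
      rw [hr]
      field_simp
      ring
    rw [hl, hr'] at hmul
    rw [zetaSum, Finset.sum_range_succ, ← zetaSum, Nat.cast_succ]
    linarith

lemma zetaSum_le_tail {b : ℝ} (hb : 0 ≤ b) {k n : ℕ} (hkn : k < n) :
    zetaSum b n ≤ (1 + k * ((k : ℝ) + 1) ^ b) *
      ∑ m ∈ Finset.Ico k n, ((m : ℝ) + 1) ^ (-b) := by
  have hhead : zetaSum b k ≤ k := by
    have : zetaSum b k ≤ ∑ _m ∈ Finset.range k, (1 : ℝ) :=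
      Finset.sum_le_sum fun m _ => Real.rpow_le_one_of_one_le_of_nonpos (by simp) (by linarith)
    simpa using this
  have htail : ((k : ℝ) + 1) ^ (-b) ≤ ∑ m ∈ Finset.Ico k n, ((m : ℝ) + 1) ^ (-b) :=
    Finset.single_le_sum (f := fun m : ℕ => ((m : ℝ) + 1) ^ (-b))
      (fun _ _ => by positivity) (Finset.mem_Ico.2 ⟨le_rfl, hkn⟩)
  have hsplit : zetaSum b n = zetaSum b k + ∑ m ∈ Finset.Ico k n, ((m : ℝ) + 1) ^ (-b) :=
    (Finset.sum_range_add_sum_Ico _ hkn.le).symm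
  have hone : ((k : ℝ) + 1) ^ b * ((k : ℝ) + 1) ^ (-b) = 1 := by
    rw [← Real.rpow_add (by positivity), add_neg_cancel, Real.rpow_zero]
  have hk := mul_le_mul_of_nonneg_left htail
    (show 0 ≤ (k : ℝ) * ((k : ℝ) + 1) ^ b by positivity)
  rw [mul_assoc, hone, mul_one] at hk
  linarith

lemma Fsum_le_prod_zetaSum (k : ℕ) (a : Fin k → ℝ) (n : ℕ) :
    Fsum k a n ≤ ∏ j, zetaSum (a j) n := by
  simp only [zetaSum, Finset.sum_range, Finset.prod_univ_sum, Fintype.piFinset_univ]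
  exact Finset.sum_le_sum_of_subset_of_nonneg (Finset.filter_subset _ _)
    fun _ _ _ => Finset.prod_nonneg fun _ _ => by positivity

lemma le_Fsum_succ (k : ℕ) (a : Fin (k + 1) → ℝ) (n : ℕ) :
    (∏ j : Fin k, (((j : ℕ) : ℝ) + 1) ^ (-(a j.castSucc))) *
      ∑ m ∈ Finset.Ico k n, ((m : ℝ) + 1) ^ (-(a (Fin.last k))) ≤ Fsum (k + 1) a n := by
  rcases le_or_gt n k with hnk | hkn
  · rw [Finset.Ico_eq_empty_of_le hnk, Finset.sum_empty, mul_zero]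
    exact Finset.sum_nonneg fun _ _ => Finset.prod_nonneg fun _ _ => by positivity
  let g : ℕ → Fin (k + 1) → Fin n := fun m =>
    Fin.snoc (α := fun _ => Fin n) (Fin.castLE hkn.le) (if h : m < n then ⟨m, h⟩ else ⟨k, hkn⟩)
  have hlast : ∀ m ∈ Finset.Ico k n, ((g m (Fin.last k) : Fin n) : ℕ) = m := fun m hm => by
    simp [g, (Finset.mem_Ico.1 hm).2]
  have hinj : Set.InjOn g (Finset.Ico k n) := fun m hm m' hm' h => by
    rw [← hlast m hm, ← hlast m' hm', h]
  have hmono : ∀ m ∈ Finset.Ico k n, StrictMono (g m) := fun m hm => by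
    intro i j hij
    induction i using Fin.lastCases with
    | last => exact absurd hij (Fin.le_last j).not_gt
    | cast i =>
      induction j using Fin.lastCases with
      | last =>
        rw [Fin.lt_def, hlast m hm]
        simpa [g] using i.2.trans_le (Finset.mem_Ico.1 hm).1
      | cast j => simpa [g] using hij
  rw [Finset.mul_sum]
  calc _ = ∑ m ∈ Finset.Ico k n, ∏ j, (((g m j : ℕ) : ℝ) + 1) ^ (-(a j)) := by
        refine Finset.sum_congr rfl fun m hm => ?_
        rw [Fin.prod_univ_castSucc, hlast m hm]
        simp [g]
    _ = ∑ f ∈ (Finset.Ico k n).image g, ∏ j, (((f j : ℕ) : ℝ) + 1) ^ (-(a j)) :=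
        (Finset.sum_image (f := fun f : Fin (k + 1) → Fin n =>
          ∏ j, (((f j : ℕ) : ℝ) + 1) ^ (-(a j))) hinj).symm
    _ ≤ Fsum (k + 1) a n := by
        refine Finset.sum_le_sum_of_subset_of_nonneg (fun f hf => ?_)
          fun _ _ _ => Finset.prod_nonneg fun _ _ => by positivity
        obtain ⟨m, hm, rfl⟩ := Finset.mem_image.1 hf
        exact Finset.mem_filter.2 ⟨Finset.mem_univ _, hmono m hm⟩

/-- If all exponents but the last exceed `1`, then `Fsum` is comparable with the truncated zeta
sum of the last exponent. -/
lemma exists_Fsum_comparable_zetaSum (k : ℕ) (a : Fin (k + 1) → ℝ)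
    (ha : ∀ j : Fin k, 1 < a j.castSucc) (hlast : 0 ≤ a (Fin.last k)) :
    ∃ c C : ℝ, 0 < c ∧ 0 < C ∧ ∀ n, k < n →
      c * zetaSum (a (Fin.last k)) n ≤ Fsum (k + 1) a n ∧
      Fsum (k + 1) a n ≤ C * zetaSum (a (Fin.last k)) n := by
  choose B hB using fun j => exists_zetaSum_le (ha j)
  have hB0 : ∀ j, 0 < B j := fun j =>
    zero_lt_one.trans_le ((one_le_zetaSum _ one_pos).trans (hB j 1))
  set P : ℝ := ∏ j : Fin k, (((j : ℕ) : ℝ) + 1) ^ (-(a j.castSucc)) with hP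
  have hP0 : 0 < P := Finset.prod_pos fun _ _ => by positivity
  set D : ℝ := 1 + k * ((k : ℝ) + 1) ^ a (Fin.last k)
  have hD0 : 0 < D := by positivity
  refine ⟨P / D, ∏ j, B j, by positivity, Finset.prod_pos fun j _ => hB0 j,
    fun n hn => ⟨le_trans ?_ (le_Fsum_succ k a n), (Fsum_le_prod_zetaSum _ a n).trans ?_⟩⟩
  · rw [← hP, div_mul_eq_mul_div, div_le_iff₀ hD0, mul_assoc]
    refine mul_le_mul_of_nonneg_left ?_ hP0.le
    rw [mul_comm _ D]
    exact zetaSum_le_tail hlast hn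
  · rw [Fin.prod_univ_castSucc]
    exact mul_le_mul_of_nonneg_right
      (Finset.prod_le_prod (fun j _ => zetaSum_nonneg _ _) fun j _ => hB j n) (zetaSum_nonneg _ _)

/-- Order of the expected `ℓ`-clique count: with `x_i = (1-2β)(ℓ-i) + β(ℓ-1)` for
`i ∈ {1,…,ℓ}` (here `i = i₀ + 1` with `i₀ : Fin ℓ`), `F_ℓ(x₁,…,x_ℓ; n)` is of constant
order when `β > 1/(ℓ-1)`, of order `log n` when `β = 1/(ℓ-1)`, and of order
`n^{1-β(ℓ-1)}` when `β < 1/(ℓ-1)`. -/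
theorem Fsum_clique_asymptotics (ℓ : ℕ) (hℓ : 4 ≤ ℓ) (β : ℝ)
    (hβ : β ∈ Set.Ioc (0 : ℝ) (1 / 2)) :
    ∃ c C : ℝ, 0 < c ∧ c ≤ C ∧ ∀ n : ℕ, 2 * ℓ ≤ n →
      (1 / ((ℓ : ℝ) - 1) < β →
        c ≤ Fsum ℓ (fun i => (1 - 2 * β) * ((ℓ : ℝ) - (i : ℕ) - 1) + β * ((ℓ : ℝ) - 1)) n ∧
        Fsum ℓ (fun i => (1 - 2 * β) * ((ℓ : ℝ) - (i : ℕ) - 1) + β * ((ℓ : ℝ) - 1)) n ≤ C) ∧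
      (β = 1 / ((ℓ : ℝ) - 1) →
        c * Real.log n ≤
          Fsum ℓ (fun i => (1 - 2 * β) * ((ℓ : ℝ) - (i : ℕ) - 1) + β * ((ℓ : ℝ) - 1)) n ∧
        Fsum ℓ (fun i => (1 - 2 * β) * ((ℓ : ℝ) - (i : ℕ) - 1) + β * ((ℓ : ℝ) - 1)) n ≤
          C * Real.log n) ∧
      (β < 1 / ((ℓ : ℝ) - 1) →
        c * (n : ℝ) ^ (1 - β * ((ℓ : ℝ) - 1)) ≤
          Fsum ℓ (fun i => (1 - 2 * β) * ((ℓ : ℝ) - (i : ℕ) - 1) + β * ((ℓ : ℝ) - 1)) n ∧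
        Fsum ℓ (fun i => (1 - 2 * β) * ((ℓ : ℝ) - (i : ℕ) - 1) + β * ((ℓ : ℝ) - 1)) n ≤
          C * (n : ℝ) ^ (1 - β * ((ℓ : ℝ) - 1))) := by
  obtain ⟨k, rfl⟩ : ∃ k, ℓ = k + 1 := ⟨ℓ - 1, by omega⟩
  obtain ⟨hβ0, hβ1⟩ := hβ
  have hk : (3 : ℝ) ≤ k := by exact_mod_cast (show 3 ≤ k by omega)
  have hk0 : (0 : ℝ) < k := by linarith
  set a : Fin (k + 1) → ℝ := fun i =>
    (1 - 2 * β) * (((k + 1 : ℕ) : ℝ) - (i : ℕ) - 1) + β * (((k + 1 : ℕ) : ℝ) - 1) with ha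
  have hsub : ((k + 1 : ℕ) : ℝ) - 1 = k := by push_cast; ring
  have hlast : a (Fin.last k) = β * k := by simp [ha]
  have hinit : ∀ j : Fin k, 1 < a j.castSucc := fun j => by
    have hj : ((j : ℕ) : ℝ) + 1 ≤ k := by exact_mod_cast j.2
    simp only [ha, hsub, Fin.val_castSucc]
    push_cast
    nlinarith [mul_nonneg (show 0 ≤ 1 - 2 * β by linarith) (sub_nonneg.2 hj)]
  rw [hsub]
  have hb0 : 0 ≤ β * k := by positivity
  obtain ⟨c, C, hc, hC, h⟩ :=
    exists_Fsum_comparable_zetaSum k a hinit (hlast ▸ hb0)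
  rw [hlast] at h
  have reduce : ∀ G : ℕ → ℝ, (∃ c' C' : ℝ, 0 < c' ∧ ∀ n, 2 * (k + 1) ≤ n →
      0 ≤ G n ∧ c' * G n ≤ zetaSum (β * k) n ∧ zetaSum (β * k) n ≤ C' * G n) →
      ∃ c C : ℝ, 0 < c ∧ c ≤ C ∧ ∀ n, 2 * (k + 1) ≤ n →
        c * G n ≤ Fsum (k + 1) a n ∧ Fsum (k + 1) a n ≤ C * G n := by
    rintro G ⟨c', C', hc', hG⟩
    refine ⟨c * c', max (c * c') (C * C'), by positivity, le_max_left _ _, fun n hn => ?_⟩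
    obtain ⟨hG0, hG1, hG2⟩ := hG n hn
    obtain ⟨h1, h2⟩ := h n (by omega)
    constructor
    · rw [mul_assoc]
      exact (mul_le_mul_of_nonneg_left hG1 hc.le).trans h1
    · refine h2.trans ((mul_le_mul_of_nonneg_left hG2 hC.le).trans ?_)
      rw [← mul_assoc]
      exact mul_le_mul_of_nonneg_right (le_max_right _ _) hG0
  rcases lt_trichotomy β (1 / k) with hlt | heq | hgt
  · have hb1 : β * k < 1 := (lt_div_iff₀ hk0).1 hlt
    obtain ⟨c₁, C₁, hc₁, hcC, hF⟩ := reduce (fun n => (n : ℝ) ^ (1 - β * k))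
      ⟨1, 1 / (1 - β * k), one_pos, fun n hn => ⟨by positivity, by
        rw [one_mul]
        exact rpow_one_sub_le_zetaSum hb0 (by omega), by
        rw [div_mul_eq_mul_div, one_mul, le_div_iff₀ (by linarith), mul_comm]
        exact zetaSum_le_rpow_one_sub hb0 hb1 n⟩⟩
    exact ⟨c₁, C₁, hc₁, hcC, fun n hn => ⟨fun h' => absurd h' hlt.not_gt,
      fun h' => absurd h' hlt.ne, fun _ => hF n hn⟩⟩
  · have hb1 : β * k = 1 := by rw [heq]; field_simp
    obtain ⟨c₁, C₁, hc₁, hcC, hF⟩ := reduce (fun n => Real.log n)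
      ⟨1, 2, one_pos, fun n hn => by
        have hn8 : (8 : ℝ) ≤ n := by exact_mod_cast (show 8 ≤ n by omega)
        have hlog : 1 ≤ Real.log n := by
          rw [Real.le_log_iff_exp_le (by linarith)]
          linarith [Real.exp_one_lt_d9]
        rw [hb1, zetaSum_one]
        have hlow := log_add_one_le_harmonic n
        have hmono : Real.log n ≤ Real.log ((n + 1 : ℕ) : ℝ) :=
          Real.log_le_log (by linarith) (by push_cast; linarith)
        refine ⟨by linarith, by linarith, ?_⟩
        linarith [harmonic_le_one_add_log n]⟩
    exact ⟨c₁, C₁, hc₁, hcC, fun n hn => ⟨fun h' => absurd h' heq.not_gt,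
      fun _ => hF n hn, fun h' => absurd h' heq.not_lt⟩⟩
  · have hb1 : 1 < β * k := (div_lt_iff₀ hk0).1 hgt
    obtain ⟨B, hB⟩ := exists_zetaSum_le hb1
    obtain ⟨c₁, C₁, hc₁, hcC, hF⟩ := reduce (fun _ => 1)
      ⟨1, B, one_pos, fun n hn => ⟨zero_le_one, by
        rw [one_mul]
        exact one_le_zetaSum _ (by omega), by rw [mul_one]; exact hB n⟩⟩
    simp only [mul_one] at hF
    exact ⟨c₁, C₁, hc₁, hcC, fun n hn => ⟨fun _ => hF n hn,
      fun h' => absurd h' hgt.ne', fun h' => absurd h' hgt.not_gt⟩⟩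
end

section
/- Let k ≥ 3 be an integer and let H be a connected simple graph on the vertex set {1, …, k} in which every vertex has degree at least 2. For j ∈ {1,…,k} define d_j := #{ u > j : {j,u} is an edge of H } and ℓ_j := #{ edges {u,v} of H with v ≤ j < u }, with ℓ₀ := 0. Then: (a) ℓ_j − ℓ_{j−1} = 2 d_j − deg_H(j) for every j ∈ {1,…,k}; (b) ∑_{j=1}^{k} d_j = |E(H)|; and (c) for every β ∈ (1/2, 1) and every t ∈ {2, …, k}, ∑_{j=t}^{k} ( d_j − β(ℓ_j − ℓ_{j−1}) ) = ∑_{j=t}^{k} d_j + β·ℓ_{t−1} > k − t + 1. -/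
open Finset

/-- In-degree of vertex `j` when every edge of `H` is oriented from its larger endpoint
to its smaller endpoint: `d_j = #{u > j : {j,u} ∈ E(H)}`. -/
def inDeg {k : ℕ} (H : SimpleGraph (Fin k)) [DecidableRel H.Adj] (j : Fin k) : ℕ :=
  (Finset.univ.filter fun u : Fin k => j < u ∧ H.Adj j u).card

/-- Number of edges `{u,v}` of `H` crossing level `j`, i.e. with `v < j ≤ u`
(0-based; with 1-based labels this is `ℓ_j = #{edges with v ≤ j < u}`, and `ℓ₀ = L 0 = 0`). -/
def crossCount {k : ℕ} (H : SimpleGraph (Fin k)) [DecidableRel H.Adj] (j : ℕ) : ℕ :=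
  (Finset.univ.filter fun p : Fin k × Fin k =>
    (p.2 : ℕ) < j ∧ j ≤ (p.1 : ℕ) ∧ H.Adj p.1 p.2).card

section CrossCount

variable {k : ℕ} (H : SimpleGraph (Fin k)) [DecidableRel H.Adj]

theorem card_filter_lt_add_inDeg (j : Fin k) :
    (univ.filter fun u : Fin k => u < j ∧ H.Adj j u).card + inDeg H j = H.degree j := by
  rw [inDeg, ← card_union_of_disjoint, ← H.card_neighborFinset_eq_degree]
  · congr 1
    ext u
    have hne : H.Adj j u → j ≠ u := H.ne_of_adj
    simp only [mem_union, mem_filter, mem_univ, true_and, SimpleGraph.mem_neighborFinset]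
    grind
  · rw [disjoint_filter]
    grind

theorem crossCount_succ_add (j : Fin k) :
    crossCount H ((j : ℕ) + 1) + (univ.filter fun u : Fin k => u < j ∧ H.Adj j u).card =
      crossCount H (j : ℕ) + inDeg H j := by
  have hl : (univ.filter fun u : Fin k => u < j ∧ H.Adj j u).card =
      (univ.filter fun p : Fin k × Fin k => p.1 = j ∧ p.2 < j ∧ H.Adj p.1 p.2).card := by
    refine card_bij (fun u _ => (j, u)) ?_ ?_ ?_ <;> simp +contextual
  have hr : inDeg H j =
      (univ.filter fun p : Fin k × Fin k => p.2 = j ∧ j < p.1 ∧ H.Adj p.1 p.2).card := by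
    refine card_bij (fun u _ => (u, j)) ?_ ?_ ?_ <;> simp +contextual [H.adj_comm]
  rw [hl, hr]
  simp only [crossCount, card_filter, ← sum_add_distrib]
  refine sum_congr rfl fun p _ => ?_
  by_cases h : H.Adj p.1 p.2
  · simp only [h, and_true, Fin.ext_iff, Fin.lt_def]
    split_ifs <;> omega
  · simp [h]

theorem crossCount_succ_sub (j : Fin k) :
    (crossCount H ((j : ℕ) + 1) : ℤ) - (crossCount H (j : ℕ) : ℤ) =
      2 * (inDeg H j : ℤ) - (H.degree j : ℤ) := by
  have h₁ := card_filter_lt_add_inDeg H j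
  have h₂ := crossCount_succ_add H j
  omega

theorem crossCount_zero : crossCount H 0 = 0 := by
  simp [crossCount]

theorem crossCount_self : crossCount H k = 0 := by
  simp only [crossCount, card_eq_zero, filter_eq_empty_iff]
  intro p _
  have := p.1.isLt
  omega

theorem sum_Ici_crossCount_succ_sub (t : Fin k) :
    ∑ j ∈ Ici t, ((crossCount H ((j : ℕ) + 1) : ℤ) - (crossCount H (j : ℕ) : ℤ)) =
      -(crossCount H (t : ℕ) : ℤ) := by
  have h := sum_map (Ici t) Fin.valEmbedding
    fun i : ℕ => (crossCount H (i + 1) : ℤ) - (crossCount H i : ℤ)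
  rw [Fin.map_valEmbedding_Ici, sum_Ico_sub (fun i => (crossCount H i : ℤ)) t.isLt.le,
    crossCount_self] at h
  simpa using h.symm

theorem sum_inDeg : ∑ j : Fin k, inDeg H j = H.edgeFinset.card := by
  have h := Fin.sum_univ_eq_sum_range
    (fun i : ℕ => (crossCount H (i + 1) : ℤ) - (crossCount H i : ℤ)) k
  rw [sum_range_sub (fun i => (crossCount H i : ℤ)), crossCount_self, crossCount_zero] at h
  simp only [crossCount_succ_sub, sum_sub_distrib, ← mul_sum] at h
  have hs := H.sum_degrees_eq_twice_card_edges
  zify at hs ⊢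
  push_cast at h
  linarith

variable {H} in
theorem crossCount_pos (hconn : H.Connected) (t : Fin k) (ht : 1 ≤ (t : ℕ)) :
    0 < crossCount H (t : ℕ) := by
  obtain ⟨w⟩ := hconn.preconnected ⟨0, by omega⟩ t
  obtain ⟨d, -, h₁, h₂⟩ := w.exists_boundary_dart {v | (v : ℕ) < t} ht (by simp)
  refine card_pos.2 ⟨(d.snd, d.fst), ?_⟩
  simp only [Set.mem_ofPred_eq, not_lt] at h₁ h₂
  simpa using ⟨h₁, h₂, d.adj.symm⟩

variable {H} in
theorem two_mul_le_two_mul_sum_Ici_inDeg_add (hdeg : ∀ v : Fin k, 2 ≤ H.degree v) (t : Fin k) :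
    2 * ((k : ℤ) - (t : ℕ)) ≤ 2 * ∑ j ∈ Ici t, (inDeg H j : ℤ) + crossCount H (t : ℕ) := by
  have h := sum_Ici_crossCount_succ_sub H t
  simp only [crossCount_succ_sub, sum_sub_distrib, ← mul_sum] at h
  have hd : (Ici t).card • (2 : ℤ) ≤ ∑ j ∈ Ici t, (H.degree j : ℤ) :=
    card_nsmul_le_sum _ _ _ fun v _ => by exact_mod_cast hdeg v
  rw [Fin.card_Ici, nsmul_eq_mul, Nat.cast_sub t.isLt.le] at hd
  linarith

end CrossCount

/-- For a connected simple graph `H` on `{1,…,k}` with minimum degree 2 (vertices here are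
`Fin k`, 0-based): (a) `ℓ_j - ℓ_{j-1} = 2d_j - deg_H(j)`; (b) `∑_j d_j = |E(H)|`; and
(c) for every `β ∈ (1/2,1)` and every `t` with 1-based index in `{2,…,k}`,
`∑_{j≥t} (d_j - β(ℓ_j - ℓ_{j-1})) = ∑_{j≥t} d_j + β ℓ_{t-1} > k - t + 1`. -/
theorem graphical_exponent_lemma (k : ℕ) (hk : 3 ≤ k) (H : SimpleGraph (Fin k))
    [DecidableRel H.Adj] (hconn : H.Connected) (hdeg : ∀ v : Fin k, 2 ≤ H.degree v) :
    (∀ j : Fin k, (crossCount H ((j : ℕ) + 1) : ℤ) - (crossCount H (j : ℕ) : ℤ) =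
      2 * (inDeg H j : ℤ) - (H.degree j : ℤ)) ∧
    (∑ j : Fin k, inDeg H j = H.edgeFinset.card) ∧
    (∀ β : ℝ, β ∈ Set.Ioo (1 / 2 : ℝ) 1 → ∀ t : Fin k, 1 ≤ (t : ℕ) →
      (∑ j ∈ Finset.Ici t,
          ((inDeg H j : ℝ) - β * ((crossCount H ((j : ℕ) + 1) : ℝ) - (crossCount H (j : ℕ) : ℝ)))
        = (∑ j ∈ Finset.Ici t, (inDeg H j : ℝ)) + β * (crossCount H (t : ℕ) : ℝ)) ∧
      ((k : ℝ) - (t : ℕ) <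
        (∑ j ∈ Finset.Ici t, (inDeg H j : ℝ)) + β * (crossCount H (t : ℕ) : ℝ))) := by
  refine ⟨crossCount_succ_sub H, sum_inDeg H, fun β hβ t ht => ⟨?_, ?_⟩⟩
  · have h := sum_Ici_crossCount_succ_sub H t
    rify at h
    rw [sum_sub_distrib, ← mul_sum, h]
    ring
  · have hpos := crossCount_pos hconn t ht
    have h := two_mul_le_two_mul_sum_Ici_inDeg_add hdeg t
    rify at hpos h
    nlinarith [mul_pos (sub_pos.2 hβ.1) hpos]
end
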